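/- For every integer J ≥ 2 and every λ ∈ (0,1/2), the sum of |μ(j₁,j₂,λ)| over all pairs of integers (j₁,j₂) with |j₁| ≤ J, |j₂| ≤ J and (j₁,j₂) ≠ (0,0) is at most K(λJ² + λ^{1/2}J^{1/2} log J), where K is a constant depending only on f, c₁, c₂ and I. -/

import Mathlib

open Set Real MeasureTheory

/-- Distance from a real number to the nearest integer. -/
noncomputable def nint (y : ℝ) : ℝ := |y - round y|

/-- `f` has at every point a tangent line, of slope `p x`, from which it deviates quadratically. -/
def QuadraticDeviation (c₁ c₂ : ℝ) (f p : ℝ → ℝ) : Prop :=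
  ∀ x y, c₁ / 2 * (y - x) ^ 2 ≤ f y - f x - p x * (y - x) ∧
    f y - f x - p x * (y - x) ≤ c₂ / 2 * (y - x) ^ 2

namespace QuadraticDeviation

variable {c₁ c₂ : ℝ} {f p : ℝ → ℝ}

lemma le (h : QuadraticDeviation c₁ c₂ f p) : c₁ ≤ c₂ := by
  have := h 0 1
  linarith [this.1, this.2]

lemma slope_lower (h : QuadraticDeviation c₁ c₂ f p) {x y : ℝ} (hxy : x ≤ y) :
    c₁ * (y - x) ≤ p y - p x := by
  rcases hxy.eq_or_lt with rfl | hlt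
  · simp
  · have h1 := (h x y).1
    have h2 := (h y x).1
    have : 0 < y - x := by linarith
    refine le_of_mul_le_mul_right ?_ this
    nlinarith

lemma slope_upper (h : QuadraticDeviation c₁ c₂ f p) {x y : ℝ} (hxy : x ≤ y) :
    p y - p x ≤ c₂ * (y - x) := by
  rcases hxy.eq_or_lt with rfl | hlt
  · simp
  · have h1 := (h x y).2
    have h2 := (h y x).2
    have : 0 < y - x := by linarith
    refine le_of_mul_le_mul_right ?_ this
    nlinarith

lemma abs_slope_upper (h : QuadraticDeviation c₁ c₂ f p) (hc : 0 < c₁) (x y : ℝ) :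
    |p y - p x| ≤ c₂ * |y - x| := by
  rcases le_total x y with hxy | hxy
  · have h1 := h.slope_lower hxy
    have : 0 ≤ c₁ * (y - x) := mul_nonneg hc.le (by linarith)
    rw [abs_of_nonneg (by linarith), abs_of_nonneg (by linarith)]
    exact h.slope_upper hxy
  · have h1 := h.slope_lower hxy
    have : 0 ≤ c₁ * (x - y) := mul_nonneg hc.le (by linarith)
    rw [abs_of_nonpos (by linarith), abs_of_nonpos (by linarith)]
    have := h.slope_upper hxy
    linarith

/-- Two points on the same side of `z` whose tangent lines pass within `τ` of the same point on
the vertical line through `z`. -/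
lemma tangent_gap (h : QuadraticDeviation c₁ c₂ f p) (hc : 0 < c₁) {x y z t τ : ℝ}
    (hside : (z ≤ x ∧ x ≤ y) ∨ (y ≤ x ∧ x ≤ z))
    (hx : |t - f x - p x * (z - x)| ≤ τ) (hy : |t - f y - p y * (z - y)| ≤ τ) :
    c₁ / 2 * (y - x) ^ 2 + |p y - p x| * |x - z| ≤ 2 * τ := by
  have h1 := (h y x).1
  rw [abs_le] at hx hy
  have hp : |p y - p x| * |x - z| = (p y - p x) * (x - z) := by
    rw [← abs_mul]
    apply abs_of_nonneg
    rcases hside with ⟨ha, hb⟩ | ⟨ha, hb⟩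
    · have := h.slope_lower hb
      have : 0 ≤ c₁ * (y - x) := mul_nonneg hc.le (by linarith)
      exact mul_nonneg (by linarith) (by linarith)
    · have := h.slope_lower ha
      have : 0 ≤ c₁ * (x - y) := mul_nonneg hc.le (by linarith)
      exact mul_nonneg_of_nonpos_of_nonpos (by linarith) (by linarith)
  rw [hp]
  nlinarith

end QuadraticDeviation

lemma card_Icc_ceil_floor_le {α β : ℝ} (h : α ≤ β) :
    ((Finset.Icc ⌈α⌉ ⌊β⌋).card : ℝ) ≤ β - α + 1 := by
  rw [Int.card_Icc]
  rcases le_total 0 (⌊β⌋ + 1 - ⌈α⌉) with h0 | h0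
  · have : (((⌊β⌋ + 1 - ⌈α⌉).toNat : ℤ) : ℝ) = ((⌊β⌋ + 1 - ⌈α⌉ : ℤ) : ℝ) := by
      rw [Int.toNat_of_nonneg h0]
    rw [Int.cast_natCast] at this
    rw [this]
    push_cast
    linarith [Int.floor_le β, Int.le_ceil α]
  · rw [Int.toNat_of_nonpos h0]
    push_cast
    linarith

lemma card_le_of_separated {ι : Type*} (S : Finset ι) (s : ι → ℝ) {d D : ℝ} (hd : 0 < d)
    (hD : 0 ≤ D) (hsep : ∀ i ∈ S, ∀ j ∈ S, i ≠ j → d ≤ |s i - s j|)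
    (hspread : ∀ i ∈ S, ∀ j ∈ S, |s i - s j| ≤ D) : (S.card : ℝ) ≤ D / d + 1 := by
  classical
  rcases S.eq_empty_or_nonempty with rfl | hne
  · simp; positivity
  obtain ⟨m, hm, hmin⟩ := S.exists_min_image s hne
  have hcard : S.card ≤ (Finset.Icc ⌈(0 : ℝ)⌉ ⌊D / d⌋).card := by
    refine Finset.card_le_card_of_injOn (fun i => ⌊(s i - s m) / d⌋) ?_ ?_
    · intro i hi
      simp only [Finset.coe_Icc, Set.mem_Icc, Int.ceil_zero]
      refine ⟨Int.floor_nonneg.2 (div_nonneg (sub_nonneg.2 (hmin i hi)) hd.le), ?_⟩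
      apply Int.floor_le_floor
      gcongr
      exact (le_abs_self _).trans (hspread i hi m hm)
    · intro i hi j hj hij
      by_contra hne
      have h1 := hsep i hi j hj hne
      have h2 := Int.abs_sub_lt_one_of_floor_eq_floor hij
      rw [← sub_div, abs_div, abs_of_pos hd, div_lt_one hd] at h2
      have : s i - s m - (s j - s m) = s i - s j := by ring
      rw [this] at h2
      linarith
  calc (S.card : ℝ) ≤ ((Finset.Icc ⌈(0 : ℝ)⌉ ⌊D / d⌋).card : ℝ) := by exact_mod_cast hcard
    _ ≤ D / d - 0 + 1 := card_Icc_ceil_floor_le (by positivity)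
    _ = _ := by ring

/-- An integer vector with coprime coordinates, in Bézout form. -/
def IsPrimitive (a b c : ℤ) : Prop := ∃ α β γ : ℤ, α * a + β * b + γ * c = 1

lemma exists_primitive (a b c : ℤ) (h : a ≠ 0 ∨ b ≠ 0 ∨ c ≠ 0) :
    ∃ m a' b' c' : ℤ, 0 < m ∧ a = m * a' ∧ b = m * b' ∧ c = m * c' ∧ IsPrimitive a' b' c' := by
  set m : ℤ := ((Int.gcd (Int.gcd a b) c : ℕ) : ℤ) with hm
  have hmc : m ∣ c := Int.gcd_dvd_right ..
  have hmg : m ∣ (Int.gcd a b : ℤ) := Int.gcd_dvd_left ..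
  have hma : m ∣ a := hmg.trans (Int.gcd_dvd_left ..)
  have hmb : m ∣ b := hmg.trans (Int.gcd_dvd_right ..)
  have hm0 : m ≠ 0 := by
    intro h0
    rw [h0, zero_dvd_iff] at hma hmb hmc
    tauto
  have hmpos : 0 < m := lt_of_le_of_ne (by positivity) hm0.symm
  obtain ⟨a', ha⟩ := hma
  obtain ⟨b', hb⟩ := hmb
  obtain ⟨c', hc⟩ := hmc
  refine ⟨m, a', b', c', hmpos, ha, hb, hc, ?_⟩
  have e1 := Int.gcd_eq_gcd_ab a b
  have e2 := Int.gcd_eq_gcd_ab (Int.gcd a b) c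
  rw [← hm] at e2
  set x := Int.gcdA (Int.gcd a b) c
  set y := Int.gcdB (Int.gcd a b) c
  refine ⟨x * Int.gcdA a b, x * Int.gcdB a b, y, ?_⟩
  apply mul_left_cancel₀ hm0
  calc m * (x * Int.gcdA a b * a' + x * Int.gcdB a b * b' + y * c')
      = ((m * a') * Int.gcdA a b + (m * b') * Int.gcdB a b) * x + (m * c') * y := by ring
    _ = m * 1 := by rw [← ha, ← hb, ← hc, ← e1, mul_one]; exact e2.symm

lemma dvd_of_parallel {u v w A B D : ℤ} (hl : IsPrimitive u v w)
    (h1 : w * A = u * D) (h2 : w * B = v * D) : w ∣ D := by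
  obtain ⟨α, β, γ, h⟩ := hl
  refine ⟨α * A + β * B + γ * D, ?_⟩
  linear_combination (-D) * h - α * h1 - β * h2

lemma eq_of_parallel {a q n a' q' n' : ℤ} (h : IsPrimitive a q n) (h' : IsPrimitive a' q' n')
    (hq : 0 < q) (hq' : 0 < q') (h1 : a * q' = a' * q) (h2 : n * q' = n' * q) :
    a = a' ∧ q = q' ∧ n = n' := by
  have d1 : q ∣ q' := by
    obtain ⟨α, β, γ, e⟩ := h
    exact ⟨α * a' + β * q' + γ * n', by linear_combination (-q') * e + α * h1 + γ * h2⟩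
  have d2 : q' ∣ q := by
    obtain ⟨α, β, γ, e⟩ := h'
    exact ⟨α * a + β * q + γ * n, by linear_combination (-q) * e - α * h1 - γ * h2⟩
  have e := Int.dvd_antisymm hq.le hq'.le d1 d2
  subst e
  exact ⟨mul_right_cancel₀ hq.ne' h1, rfl, mul_right_cancel₀ hq.ne' h2⟩

/-- The point with tangent slope `-a / q`, for an inverse `X` of the slope function. -/
noncomputable def stationaryPoint (X : ℝ → ℝ) (j : ℤ × ℤ × ℤ) : ℝ := X (-((j.1 : ℝ) / j.2.1))

/-- The value of `a y + q f y + n` at its stationary point. -/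
noncomputable def stationaryValue (f X : ℝ → ℝ) (j : ℤ × ℤ × ℤ) : ℝ :=
  j.1 * stationaryPoint X j + j.2.1 * f (stationaryPoint X j) + j.2.2

/-- Primitive `(a, q, n)` with `0 < q ≤ Q` whose line `a x + q y + n = 0` is, up to a vertical
translation by at most `τ`, a tangent to the graph of `f`. -/
structure IsNearTangent (f X : ℝ → ℝ) (Q τ : ℝ) (j : ℤ × ℤ × ℤ) : Prop where
  primitive : IsPrimitive j.1 j.2.1 j.2.2
  pos : 0 < j.2.1
  le : (j.2.1 : ℝ) ≤ Q
  near : |stationaryValue f X j| ≤ τ * j.2.1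

namespace IsNearTangent

variable {c₁ c₂ Q τ : ℝ} {f p X : ℝ → ℝ}

lemma pos' {j : ℤ × ℤ × ℤ} (hj : IsNearTangent f X Q τ j) : (0 : ℝ) < j.2.1 :=
  Int.cast_pos.2 hj.pos

lemma slope (hX : ∀ s, p (X s) = s) {j : ℤ × ℤ × ℤ} (hj : IsNearTangent f X Q τ j) :
    (j.1 : ℝ) = -(j.2.1 * p (stationaryPoint X j)) := by
  have := hj.pos'
  rw [stationaryPoint, hX]
  field_simp

lemma slope_sub (hX : ∀ s, p (X s) = s) {j k : ℤ × ℤ × ℤ} (hj : IsNearTangent f X Q τ j)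
    (hk : IsNearTangent f X Q τ k) :
    (j.2.1 * k.2.1 : ℝ) * (p (stationaryPoint X j) - p (stationaryPoint X k)) =
      ((k.1 * j.2.1 - j.1 * k.2.1 : ℤ) : ℝ) := by
  push_cast
  rw [hj.slope hX, hk.slope hX]
  ring

lemma mul_le {j k : ℤ × ℤ × ℤ} (hj : IsNearTangent f X Q τ j) (hk : IsNearTangent f X Q τ k) :
    (j.2.1 * k.2.1 : ℝ) ≤ Q ^ 2 := by
  have := hj.pos'
  have := hk.pos'
  nlinarith [hj.le, hk.le]

lemma eq_of_slope_eq (hτ : 0 ≤ τ) (hτQ : 2 * τ * Q ^ 2 < 1) {j k : ℤ × ℤ × ℤ}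
    (hj : IsNearTangent f X Q τ j) (hk : IsNearTangent f X Q τ k)
    (h : j.1 * k.2.1 = k.1 * j.2.1) : j = k := by
  have hjp := hj.pos'
  have hkp := hk.pos'
  have hR : (j.1 : ℝ) * k.2.1 = k.1 * j.2.1 := by exact_mod_cast h
  have hx : stationaryPoint X j = stationaryPoint X k := by
    unfold stationaryPoint
    congr 2
    rw [div_eq_div_iff hjp.ne' hkp.ne', hR]
  have e : ((j.2.2 * k.2.1 - k.2.2 * j.2.1 : ℤ) : ℝ) =
      k.2.1 * stationaryValue f X j - j.2.1 * stationaryValue f X k := by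
    push_cast
    unfold stationaryValue
    rw [hx]
    linear_combination (-(stationaryPoint X k)) * hR
  have hlt : |((j.2.2 * k.2.1 - k.2.2 * j.2.1 : ℤ) : ℝ)| < 1 := by
    rw [e]
    calc _ ≤ |k.2.1 * stationaryValue f X j| + |j.2.1 * stationaryValue f X k| := abs_sub _ _
      _ = k.2.1 * |stationaryValue f X j| + j.2.1 * |stationaryValue f X k| := by
        rw [abs_mul, abs_mul, abs_of_pos hjp, abs_of_pos hkp]
      _ ≤ k.2.1 * (τ * j.2.1) + j.2.1 * (τ * k.2.1) := by
        gcongr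
        exacts [hj.near, hk.near]
      _ = 2 * τ * (j.2.1 * k.2.1) := by ring
      _ ≤ 2 * τ * Q ^ 2 := by gcongr; exact hj.mul_le hk
      _ < 1 := hτQ
  have h0 : j.2.2 * k.2.1 - k.2.2 * j.2.1 = 0 := by
    rw [← Int.abs_lt_one_iff]
    exact_mod_cast hlt
  obtain ⟨e1, e2, e3⟩ := eq_of_parallel hj.primitive hk.primitive hj.pos hk.pos h
    (sub_eq_zero.1 h0)
  exact Prod.ext e1 (Prod.ext e2 e3)

/-- Near-tangents through a common point `(u / w, v / w)` satisfy the incidence inequality. -/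
lemma incidence (hX : ∀ s, p (X s) = s) {j : ℤ × ℤ × ℤ} (hj : IsNearTangent f X Q τ j)
    {u v w : ℤ} (hw : 0 < w) (h : u * j.1 + v * j.2.1 + w * j.2.2 = 0) :
    |(v / w : ℝ) - f (stationaryPoint X j) - p (stationaryPoint X j) *
      (u / w - stationaryPoint X j)| ≤ τ := by
  have hq := hj.pos'
  have hw' : (0 : ℝ) < w := Int.cast_pos.2 hw
  have hR : (u * j.1 + v * j.2.1 + w * j.2.2 : ℝ) = 0 := by exact_mod_cast h
  have hs := hj.slope hX
  have e : j.2.1 * ((v / w : ℝ) - f (stationaryPoint X j) - p (stationaryPoint X j) *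
      (u / w - stationaryPoint X j)) = - stationaryValue f X j := by
    have hR' : (u / w * j.1 + v / w * j.2.1 + j.2.2 : ℝ) = 0 := by
      field_simp
      linarith
    unfold stationaryValue
    linear_combination hR' - (u / w - stationaryPoint X j) * hs
  have := hj.near
  rw [← abs_neg, ← e, abs_mul, abs_of_pos hq, mul_comm] at this
  exact le_of_mul_le_mul_right this hq

lemma slope_separated (hX : ∀ s, p (X s) = s) (hτ : 0 ≤ τ) (hτQ : 2 * τ * Q ^ 2 < 1)
    (hQ : 0 < Q) {j k : ℤ × ℤ × ℤ} (hj : IsNearTangent f X Q τ j)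
    (hk : IsNearTangent f X Q τ k) (hne : j ≠ k) {u v w : ℤ}
    (hl : IsPrimitive u v w) (h1 : u * j.1 + v * j.2.1 + w * j.2.2 = 0)
    (h2 : u * k.1 + v * k.2.1 + w * k.2.2 = 0) :
    w / Q ^ 2 ≤ |p (stationaryPoint X j) - p (stationaryPoint X k)| := by
  have hjp := hj.pos'
  have hkp := hk.pos'
  have hD : k.1 * j.2.1 - j.1 * k.2.1 ≠ 0 := by
    intro h0
    exact hne (hj.eq_of_slope_eq hτ hτQ hk (by linarith))
  have hdvd : w ∣ k.1 * j.2.1 - j.1 * k.2.1 :=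
    dvd_of_parallel hl (A := k.2.1 * j.2.2 - j.2.1 * k.2.2) (B := j.1 * k.2.2 - k.1 * j.2.2)
      (by linear_combination k.2.1 * h1 - j.2.1 * h2) (by linear_combination j.1 * h2 - k.1 * h1)
  have hle : w ≤ |k.1 * j.2.1 - j.1 * k.2.1| := Int.le_of_dvd (abs_pos.2 hD) (by rwa [dvd_abs])
  have hle' : (w : ℝ) ≤ |((k.1 * j.2.1 - j.1 * k.2.1 : ℤ) : ℝ)| := by exact_mod_cast hle
  rw [← hj.slope_sub hX hk, abs_mul, abs_of_pos (by positivity)] at hle'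
  rw [div_le_iff₀ (by positivity), mul_comm]
  refine hle'.trans ?_
  gcongr
  exact hj.mul_le hk

lemma gap_bound (hf : QuadraticDeviation c₁ c₂ f p) (hc : 0 < c₁) {x y z t : ℝ}
    (hside : (z ≤ x ∧ z ≤ y) ∨ (x < z ∧ y < z))
    (hx : |t - f x - p x * (z - x)| ≤ τ) (hy : |t - f y - p y * (z - y)| ≤ τ) :
    |p x - p y| ≤ 2 * c₂ / √c₁ * √τ := by
  have hτ : 0 ≤ τ := (abs_nonneg _).trans hx
  have hc₂ : 0 < c₂ := hc.trans_le hf.le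
  have key : c₁ / 2 * (x - y) ^ 2 ≤ 2 * τ := by
    rcases hside with ⟨h1, h2⟩ | ⟨h1, h2⟩ <;> rcases le_total x y with h | h
    · have := hf.tangent_gap hc (Or.inl ⟨h1, h⟩) hx hy
      nlinarith [mul_nonneg (abs_nonneg (p y - p x)) (abs_nonneg (x - z))]
    · have := hf.tangent_gap hc (Or.inl ⟨h2, h⟩) hy hx
      nlinarith [mul_nonneg (abs_nonneg (p x - p y)) (abs_nonneg (y - z))]
    · have := hf.tangent_gap hc (Or.inr ⟨h, h2.le⟩) hy hx
      nlinarith [mul_nonneg (abs_nonneg (p x - p y)) (abs_nonneg (y - z))]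
    · have := hf.tangent_gap hc (Or.inr ⟨h, h1.le⟩) hx hy
      nlinarith [mul_nonneg (abs_nonneg (p y - p x)) (abs_nonneg (x - z))]
  have hxy : |x - y| ≤ 2 / √c₁ * √τ := by
    apply abs_le_of_sq_le_sq
    · rw [mul_pow, div_pow, sq_sqrt hc.le, sq_sqrt hτ, div_mul_eq_mul_div, le_div_iff₀ hc]
      linarith
    · positivity
  calc |p x - p y| ≤ c₂ * |x - y| := hf.abs_slope_upper hc y x
    _ ≤ c₂ * (2 / √c₁ * √τ) := by gcongr
    _ = _ := by ring

lemma card_on_line (hf : QuadraticDeviation c₁ c₂ f p) (hc : 0 < c₁) (hX : ∀ s, p (X s) = s)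
    (hτ : 0 ≤ τ) (hτQ : 2 * τ * Q ^ 2 < 1) (hQ : 0 < Q) {u v w : ℤ} (hw : 0 < w)
    (hl : IsPrimitive u v w) (S : Finset (ℤ × ℤ × ℤ)) (hS : ∀ j ∈ S, IsNearTangent f X Q τ j)
    (hline : ∀ j ∈ S, u * j.1 + v * j.2.1 + w * j.2.2 = 0) :
    (S.card : ℝ) ≤ 2 * (2 * c₂ / √c₁ * √τ / (w / Q ^ 2) + 1) := by
  have hc₂ : 0 < c₂ := hc.trans_le hf.le
  have hw' : (0 : ℝ) < w := Int.cast_pos.2 hw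
  have side : ∀ (P : ℤ × ℤ × ℤ → Prop) [DecidablePred P],
      (∀ j k, P j → P k →
        ((u / w : ℝ) ≤ stationaryPoint X j ∧ (u / w : ℝ) ≤ stationaryPoint X k) ∨
        (stationaryPoint X j < (u / w : ℝ) ∧ stationaryPoint X k < (u / w : ℝ))) →
      ((S.filter P).card : ℝ) ≤ 2 * c₂ / √c₁ * √τ / (w / Q ^ 2) + 1 := by
    intro P _ hP
    refine card_le_of_separated _ (fun j => p (stationaryPoint X j)) (by positivity)
      (by positivity) ?_ ?_
    · intro j hj k hk hne
      rw [Finset.mem_filter] at hj hk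
      exact slope_separated hX hτ hτQ hQ (hS j hj.1) (hS k hk.1) hne hl (hline j hj.1)
        (hline k hk.1)
    · intro j hj k hk
      rw [Finset.mem_filter] at hj hk
      exact gap_bound hf hc (hP j k hj.2 hk.2) ((hS j hj.1).incidence hX hw (hline j hj.1))
        ((hS k hk.1).incidence hX hw (hline k hk.1))
  classical
  rw [← Finset.card_filter_add_card_filter_not (fun j => (u / w : ℝ) ≤ stationaryPoint X j)]
  push_cast
  have h1 := side (fun j => (u / w : ℝ) ≤ stationaryPoint X j) (fun j k h1 h2 => Or.inl ⟨h1, h2⟩)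
  have h2 := side (fun j => ¬ (u / w : ℝ) ≤ stationaryPoint X j)
    (fun j k h1 h2 => Or.inr ⟨not_le.1 h1, not_le.1 h2⟩)
  linarith

lemma frame_bound (hf : QuadraticDeviation c₁ c₂ f p) (hc : 0 < c₁) (hX : ∀ s, p (X s) = s)
    (hQ : 0 < Q) {κ : ℝ} (hκ : 0 < κ) (hτQ : τ * Q ^ 2 ≤ κ) {j : ℤ × ℤ × ℤ}
    (hj : IsNearTangent f X Q τ j) {y : ℝ} (hy : |stationaryPoint X j - y| ≤ κ / Q) :
    |(j.1 : ℝ) + j.2.1 * p y| ≤ c₂ * κ ∧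
      |(j.1 : ℝ) * y + j.2.1 * f y + j.2.2| ≤ (κ + c₂ / 2 * κ ^ 2) / Q := by
  have hc₂ : 0 < c₂ := hc.trans_le hf.le
  have hq := hj.pos'
  have hs := hj.slope hX
  have hle := hj.le
  set x := stationaryPoint X j with hx
  constructor
  · have e : (j.1 : ℝ) + j.2.1 * p y = j.2.1 * (p y - p x) := by rw [hs]; ring
    rw [e, abs_mul, abs_of_pos hq]
    calc (j.2.1 : ℝ) * |p y - p x| ≤ Q * (c₂ * (κ / Q)) := by
          gcongr
          refine (hf.abs_slope_upper hc x y).trans ?_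
          rw [abs_sub_comm]
          gcongr
      _ = c₂ * κ := by field_simp
  · have e : (j.1 : ℝ) * y + j.2.1 * f y + j.2.2 =
        stationaryValue f X j + j.2.1 * (f y - f x - p x * (y - x)) := by
      unfold stationaryValue
      rw [← hx]
      linear_combination (y - x) * hs
    have hd := hf x y
    have hd0 : |f y - f x - p x * (y - x)| ≤ c₂ / 2 * (κ / Q) ^ 2 := by
      have hsq : (y - x) ^ 2 ≤ (κ / Q) ^ 2 := by
        rw [← sq_abs, abs_sub_comm]
        gcongr
      have h0 : 0 ≤ c₁ / 2 * (y - x) ^ 2 := by positivity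
      rw [abs_of_nonneg (h0.trans hd.1)]
      exact hd.2.trans (by gcongr)
    have hτ : 0 ≤ τ := by
      by_contra! h
      have := (abs_nonneg _).trans hj.near
      nlinarith
    rw [e]
    calc _ ≤ |stationaryValue f X j| + |j.2.1 * (f y - f x - p x * (y - x))| := abs_add_le _ _
      _ ≤ τ * Q + Q * (c₂ / 2 * (κ / Q) ^ 2) := by
        rw [abs_mul, abs_of_pos hq]
        gcongr
        exact hj.near.trans (by gcongr)
      _ ≤ κ / Q + Q * (c₂ / 2 * (κ / Q) ^ 2) := by
        gcongr
        rw [le_div_iff₀ hQ]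
        linarith
      _ = _ := by field_simp

/-- Near-tangents with close points of tangency are concurrent. -/
lemma det_eq_zero (hf : QuadraticDeviation c₁ c₂ f p) (hc : 0 < c₁) (hX : ∀ s, p (X s) = s)
    (hQ : 0 < Q) {κ : ℝ} (hκ : 0 < κ) (hκc : 8 * (c₂ + 1) * κ ≤ 1) (hτQ : τ * Q ^ 2 ≤ κ)
    {j k l : ℤ × ℤ × ℤ} (hj : IsNearTangent f X Q τ j) (hk : IsNearTangent f X Q τ k)
    (hl : IsNearTangent f X Q τ l)
    (hjk : |stationaryPoint X k - stationaryPoint X j| ≤ κ / Q)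
    (hjl : |stationaryPoint X l - stationaryPoint X j| ≤ κ / Q) :
    (j.2.1 * k.2.2 - k.2.1 * j.2.2) * l.1 + (k.1 * j.2.2 - j.1 * k.2.2) * l.2.1 +
      (j.1 * k.2.1 - k.1 * j.2.1) * l.2.2 = 0 := by
  have hc₂ : 0 < c₂ := hc.trans_le hf.le
  set y := stationaryPoint X j with hy
  have hjj : |stationaryPoint X j - y| ≤ κ / Q := by
    rw [← hy, sub_self, abs_zero]; positivity
  obtain ⟨hA1, hB1⟩ := frame_bound hf hc hX hQ hκ hτQ hj hjj
  obtain ⟨hA2, hB2⟩ := frame_bound hf hc hX hQ hκ hτQ hk hjk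
  obtain ⟨hA3, hB3⟩ := frame_bound hf hc hX hQ hκ hτQ hl hjl
  have term : ∀ A q B : ℝ, |A| ≤ c₂ * κ → 0 < q → q ≤ Q → |B| ≤ (κ + c₂ / 2 * κ ^ 2) / Q →
      |A * q * B| ≤ c₂ * κ * (κ + c₂ / 2 * κ ^ 2) := by
    intro A q B hA hq0 hq hB
    rw [abs_mul, abs_mul, abs_of_pos hq0]
    calc |A| * q * |B| ≤ (c₂ * κ) * Q * ((κ + c₂ / 2 * κ ^ 2) / Q) := by gcongr
      _ = _ := by field_simp
  rw [← Int.abs_lt_one_iff]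
  have hlt : |(((j.2.1 * k.2.2 - k.2.1 * j.2.2) * l.1 + (k.1 * j.2.2 - j.1 * k.2.2) * l.2.1 +
      (j.1 * k.2.1 - k.1 * j.2.1) * l.2.2 : ℤ) : ℝ)| < 1 := by
    have t1 := term _ _ _ hA1 hk.pos' hk.le hB3
    have t2 := term _ _ _ hA1 hl.pos' hl.le hB2
    have t3 := term _ _ _ hA2 hj.pos' hj.le hB3
    have t4 := term _ _ _ hA2 hl.pos' hl.le hB1
    have t5 := term _ _ _ hA3 hj.pos' hj.le hB2
    have t6 := term _ _ _ hA3 hk.pos' hk.le hB1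
    have small : 6 * (c₂ * κ * (κ + c₂ / 2 * κ ^ 2)) < 1 := by
      have h1 : c₂ * κ ≤ 1 / 8 := by nlinarith
      have h2 : κ ≤ 1 / 8 := by nlinarith
      have h3 : κ + c₂ / 2 * κ ^ 2 ≤ 1 := by nlinarith
      have h4 : 0 ≤ κ + c₂ / 2 * κ ^ 2 := by positivity
      nlinarith [mul_nonneg hc₂.le hκ.le]
    have e : (((j.2.1 * k.2.2 - k.2.1 * j.2.2) * l.1 + (k.1 * j.2.2 - j.1 * k.2.2) * l.2.1 +
        (j.1 * k.2.1 - k.1 * j.2.1) * l.2.2 : ℤ) : ℝ) =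
        (j.1 + j.2.1 * p y) * k.2.1 * (l.1 * y + l.2.1 * f y + l.2.2)
        - (j.1 + j.2.1 * p y) * l.2.1 * (k.1 * y + k.2.1 * f y + k.2.2)
        - (k.1 + k.2.1 * p y) * j.2.1 * (l.1 * y + l.2.1 * f y + l.2.2)
        + (k.1 + k.2.1 * p y) * l.2.1 * (j.1 * y + j.2.1 * f y + j.2.2)
        + (l.1 + l.2.1 * p y) * j.2.1 * (k.1 * y + k.2.1 * f y + k.2.2)
        - (l.1 + l.2.1 * p y) * k.2.1 * (j.1 * y + j.2.1 * f y + j.2.2) := by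
      push_cast
      ring
    rw [abs_le] at t1 t2 t3 t4 t5 t6
    rw [e, abs_lt]
    constructor <;> linarith
  exact_mod_cast hlt

/-- Three near-tangents with close points of tangency pass through a common rational point whose
denominator is small and which is close to the graph. -/
lemma exists_common_point (hf : QuadraticDeviation c₁ c₂ f p) (hc : 0 < c₁)
    (hX : ∀ s, p (X s) = s) (hQ : 1 ≤ Q) {κ : ℝ} (hκ : 0 < κ) (hκc : 8 * (c₂ + 1) * κ ≤ 1)
    (hτ : 0 ≤ τ) (hτQ : τ * Q ^ 2 ≤ κ) (S : Finset (ℤ × ℤ × ℤ)) (hcard : 2 < S.card)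
    (hS : ∀ j ∈ S, IsNearTangent f X Q τ j)
    (hclose : ∀ j ∈ S, ∀ k ∈ S, |stationaryPoint X k - stationaryPoint X j| ≤ κ / Q) :
    ∃ u v w : ℤ, 0 < w ∧ IsPrimitive u v w ∧
      (∀ j ∈ S, u * j.1 + v * j.2.1 + w * j.2.2 = 0) ∧
      (w : ℝ) ≤ 2 * c₂ / √c₁ * √τ * Q ^ 2 ∧
      (∃ j ∈ S, |stationaryPoint X j - u / w| ≤ 1 / w) ∧
      |v - w * f (u / w)| ≤ 2 * c₂ / √c₁ + c₂ := by
  have hc₂ : 0 < c₂ := hc.trans_le hf.le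
  have hQ0 : 0 < Q := by linarith
  have hκ8 : κ ≤ 1 / 8 := by nlinarith
  have hτQ' : 2 * τ * Q ^ 2 < 1 := by linarith
  obtain ⟨j₁, h₁, j₂, h₂, j₃, h₃, h12, h13, h23⟩ := Finset.two_lt_card.1 hcard
  have hD : j₁.1 * j₂.2.1 - j₂.1 * j₁.2.1 ≠ 0 := fun h0 =>
    h12 ((hS _ h₁).eq_of_slope_eq hτ hτQ' (hS _ h₂) (sub_eq_zero.1 h0))
  obtain ⟨u, v, w, hw, hl, hline⟩ : ∃ u v w : ℤ, 0 < w ∧ IsPrimitive u v w ∧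
      ∀ j ∈ S, u * j.1 + v * j.2.1 + w * j.2.2 = 0 := by
    obtain ⟨m, u, v, w, hm, hu, hv, hw, hl⟩ := exists_primitive
      (j₁.2.1 * j₂.2.2 - j₂.2.1 * j₁.2.2) (j₂.1 * j₁.2.2 - j₁.1 * j₂.2.2) _ (Or.inr (Or.inr hD))
    have hline : ∀ j ∈ S, u * j.1 + v * j.2.1 + w * j.2.2 = 0 := by
      intro j hj
      have := det_eq_zero hf hc hX hQ0 hκ hκc hτQ (hS _ h₁) (hS _ h₂) (hS _ hj)
        (hclose _ h₁ _ h₂) (hclose _ h₁ _ hj)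
      rw [hu, hv, hw] at this
      refine ((mul_eq_zero (a := m)).1 ?_).resolve_left hm.ne'
      linarith
    have hw0 : w ≠ 0 := by
      rintro rfl
      exact hD (by simpa using hw)
    rcases lt_or_gt_of_ne hw0 with h | h
    · obtain ⟨α, β, γ, e⟩ := hl
      refine ⟨-u, -v, -w, by linarith, ⟨-α, -β, -γ, by linarith⟩, fun j hj => ?_⟩
      linarith [hline j hj]
    · exact ⟨u, v, w, h, hl, hline⟩
  refine ⟨u, v, w, hw, hl, hline, ?_⟩
  have hw' : (0 : ℝ) < w := Int.cast_pos.2 hw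
  obtain ⟨j, hj, k, hk, hne, hside⟩ : ∃ j ∈ S, ∃ k ∈ S, j ≠ k ∧
      (((u / w : ℝ) ≤ stationaryPoint X j ∧ stationaryPoint X j ≤ stationaryPoint X k) ∨
        (stationaryPoint X k ≤ stationaryPoint X j ∧ stationaryPoint X j ≤ (u / w : ℝ))) := by
    have pair : ∀ j ∈ S, ∀ k ∈ S, j ≠ k →
        ((u / w : ℝ) ≤ stationaryPoint X j ↔ (u / w : ℝ) ≤ stationaryPoint X k) →
        ∃ j ∈ S, ∃ k ∈ S, j ≠ k ∧
        (((u / w : ℝ) ≤ stationaryPoint X j ∧ stationaryPoint X j ≤ stationaryPoint X k) ∨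
        (stationaryPoint X k ≤ stationaryPoint X j ∧ stationaryPoint X j ≤ (u / w : ℝ))) := by
      intro j hj k hk hne hiff
      by_cases hz : (u / w : ℝ) ≤ stationaryPoint X j
      · rcases le_total (stationaryPoint X j) (stationaryPoint X k) with h | h
        · exact ⟨j, hj, k, hk, hne, Or.inl ⟨hz, h⟩⟩
        · exact ⟨k, hk, j, hj, hne.symm, Or.inl ⟨hiff.1 hz, h⟩⟩
      · have hz' := mt hiff.2 hz
        rw [not_le] at hz hz'
        rcases le_total (stationaryPoint X j) (stationaryPoint X k) with h | h
        · exact ⟨k, hk, j, hj, hne.symm, Or.inr ⟨h, hz'.le⟩⟩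
        · exact ⟨j, hj, k, hk, hne, Or.inr ⟨h, hz.le⟩⟩
    by_cases a : (u / w : ℝ) ≤ stationaryPoint X j₁ ↔ (u / w : ℝ) ≤ stationaryPoint X j₂
    · exact pair _ h₁ _ h₂ h12 a
    · by_cases b : (u / w : ℝ) ≤ stationaryPoint X j₁ ↔ (u / w : ℝ) ≤ stationaryPoint X j₃
      · exact pair _ h₁ _ h₃ h13 b
      · exact pair _ h₂ _ h₃ h23 (by tauto)
  have ij := (hS j hj).incidence hX hw (hline j hj)
  have ik := (hS k hk).incidence hX hw (hline k hk)
  have hsep := slope_separated hX hτ hτQ' hQ0 (hS k hk) (hS j hj) hne.symm hl (hline k hk)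
    (hline j hj)
  set x := stationaryPoint X j with hx
  set y := stationaryPoint X k with hy
  have hgap : |p y - p x| ≤ 2 * c₂ / √c₁ * √τ := by
    rcases hside with ⟨h1, h2⟩ | ⟨h1, h2⟩
    · exact gap_bound hf hc (Or.inl ⟨h1.trans h2, h1⟩) ik ij
    · rcases h2.eq_or_lt with h3 | h3
      · have := hf.tangent_gap hc (Or.inr ⟨h1, h2⟩) ij ik
        have hxy : |y - x| ≤ 2 / √c₁ * √τ := by
          apply abs_le_of_sq_le_sq
          · rw [mul_pow, div_pow, sq_sqrt hc.le, sq_sqrt hτ, div_mul_eq_mul_div, le_div_iff₀ hc]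
            nlinarith [mul_nonneg (abs_nonneg (p y - p x)) (abs_nonneg (x - u / w))]
          · positivity
        calc |p y - p x| ≤ c₂ * |y - x| := hf.abs_slope_upper hc x y
          _ ≤ c₂ * (2 / √c₁ * √τ) := by gcongr
          _ = _ := by ring
      · exact gap_bound hf hc (Or.inr ⟨h1.trans_lt h3, h3⟩) ik ij
  have hwle : (w : ℝ) ≤ 2 * c₂ / √c₁ * √τ * Q ^ 2 := by
    have := hsep.trans hgap
    rwa [div_le_iff₀ (by positivity)] at this
  have hxz : |x - u / w| ≤ 2 * κ / w := by
    have h1 := hf.tangent_gap hc hside ij ik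
    have h2 : w / Q ^ 2 * |x - u / w| ≤ 2 * τ := by
      have : w / Q ^ 2 * |x - u / w| ≤ |p y - p x| * |x - u / w| := by gcongr
      have h0 : 0 ≤ c₁ / 2 * (y - x) ^ 2 := by positivity
      linarith
    rw [le_div_iff₀ hw']
    rw [div_mul_eq_mul_div, div_le_iff₀ (by positivity)] at h2
    linarith
  refine ⟨hwle, ⟨j, hj, hxz.trans ?_⟩, ?_⟩
  · gcongr
    linarith
  · have hd := hf x (u / w)
    have h0 : 0 ≤ c₁ / 2 * ((u / w : ℝ) - x) ^ 2 := by positivity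
    have hsq : ((u / w : ℝ) - x) ^ 2 ≤ (1 / w) ^ 2 := by
      rw [← sq_abs, abs_sub_comm]
      have : |x - u / w| ≤ 1 / w := hxz.trans (by gcongr; linarith)
      gcongr
    have e : |(v / w : ℝ) - f (u / w)| ≤ τ + c₂ / 2 * (1 / w) ^ 2 := by
      have e1 : (v / w : ℝ) - f (u / w) = ((v / w : ℝ) - f x - p x * (u / w - x)) -
        (f (u / w) - f x - p x * (u / w - x)) := by ring
      rw [e1]
      refine (abs_sub _ _).trans (add_le_add ij ?_)
      rw [abs_of_nonneg (h0.trans hd.1)]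
      exact hd.2.trans (by gcongr)
    have e2 : (v : ℝ) - w * f (u / w) = w * ((v / w : ℝ) - f (u / w)) := by field_simp
    have hτ1 : √τ * (τ * Q ^ 2) ≤ 1 := by
      have hQ2 : 1 ≤ Q ^ 2 := one_le_pow₀ hQ
      have : τ ≤ 1 := by nlinarith
      have : √τ ≤ 1 := Real.sqrt_le_one.2 this
      nlinarith [Real.sqrt_nonneg τ, mul_nonneg hτ (sq_nonneg Q)]
    rw [e2, abs_mul, abs_of_pos hw']
    calc (w : ℝ) * |(v / w : ℝ) - f (u / w)| ≤ w * (τ + c₂ / 2 * (1 / w) ^ 2) := by gcongr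
      _ = w * τ + c₂ / 2 * (1 / w) := by field_simp
      _ ≤ (2 * c₂ / √c₁ * √τ * Q ^ 2) * τ + c₂ / 2 * 1 := by
        gcongr
        rw [div_le_one hw']
        exact_mod_cast hw
      _ = 2 * c₂ / √c₁ * (√τ * (τ * Q ^ 2)) + c₂ / 2 := by ring
      _ ≤ 2 * c₂ / √c₁ * 1 + c₂ := by
        gcongr
        linarith
      _ = _ := by ring

end IsNearTangent

section Counting

variable {c₁ c₂ : ℝ} {f p X : ℝ → ℝ}

lemma card_rich_le (hf : QuadraticDeviation c₁ c₂ f p) (hc : 0 < c₁) (hX : ∀ s, p (X s) = s)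
    {A B Q τ : ℝ} (hAB : A ≤ B) (hQ : 1 ≤ Q) (hτ : 0 ≤ τ) (hτQ : 2 * τ * Q ^ 2 < 1)
    (S : Finset (ℤ × ℤ × ℤ)) (hS : ∀ j ∈ S, IsNearTangent f X Q τ j)
    (hpoint : ∀ j ∈ S, ∃ u v w : ℤ, 0 < w ∧ IsPrimitive u v w ∧
      u * j.1 + v * j.2.1 + w * j.2.2 = 0 ∧ (w : ℝ) ≤ 2 * c₂ / √c₁ * √τ * Q ^ 2 ∧
      A * w - 1 ≤ u ∧ u ≤ B * w + 1 ∧ |v - w * f (u / w)| ≤ 2 * c₂ / √c₁ + c₂) :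
    (S.card : ℝ) ≤ 4 * (B - A + 3) * (2 * (2 * c₂ / √c₁ + c₂) + 1) * (2 * c₂ / √c₁) ^ 2 *
      (τ * Q ^ 4) := by
  classical
  have hc₂ : 0 < c₂ := hc.trans_le hf.le
  set C := 2 * c₂ / √c₁ with hC
  have hC0 : 0 ≤ C := by positivity
  set E := C * √τ * Q ^ 2 with hE
  have hE0 : 0 ≤ E := by positivity
  have hsub : S ⊆ (Finset.Icc 1 ⌊E⌋).biUnion fun w =>
      (Finset.Icc ⌈A * w - 1⌉ ⌊B * w + 1⌋).biUnion fun u =>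
      (Finset.Icc ⌈w * f (u / w) - (C + c₂)⌉ ⌊w * f (u / w) + (C + c₂)⌋).biUnion fun v =>
      S.filter fun j => IsPrimitive u v w ∧ u * j.1 + v * j.2.1 + w * j.2.2 = 0 := by
    intro j hj
    obtain ⟨u, v, w, hw, hl, hline, hwE, hu1, hu2, hv⟩ := hpoint j hj
    rw [abs_le] at hv
    simp only [Finset.mem_biUnion, Finset.mem_filter, Finset.mem_Icc]
    exact ⟨w, ⟨hw, Int.le_floor.2 hwE⟩, u, ⟨Int.ceil_le.2 hu1, Int.le_floor.2 hu2⟩, v,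
      ⟨Int.ceil_le.2 (by linarith), Int.le_floor.2 (by linarith)⟩, hj, hl, hline⟩
  have line : ∀ u v w : ℤ, 1 ≤ w → (w : ℝ) ≤ E →
      ((S.filter fun j => IsPrimitive u v w ∧ u * j.1 + v * j.2.1 + w * j.2.2 = 0).card : ℝ)
        ≤ 4 * E / w := by
    intro u v w hw hwE
    have hw' : (0 : ℝ) < w := Int.cast_pos.2 (by linarith)
    by_cases hl : IsPrimitive u v w
    · have := IsNearTangent.card_on_line hf hc hX hτ hτQ (by linarith) (by linarith) hl
        (S.filter fun j => IsPrimitive u v w ∧ u * j.1 + v * j.2.1 + w * j.2.2 = 0)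
        (fun j hj => hS j (Finset.mem_filter.1 hj).1) (fun j hj => (Finset.mem_filter.1 hj).2.2)
      refine this.trans ?_
      have e : 2 * c₂ / √c₁ * √τ / (w / Q ^ 2) = E / w := by
        rw [hE, hC, div_div_eq_mul_div]
      rw [e]
      have : 1 ≤ E / w := by rwa [le_div_iff₀ hw', one_mul]
      have : 4 * E / w = 4 * (E / w) := by ring
      linarith
    · rw [Finset.filter_false_of_mem (by tauto)]
      simp only [Finset.card_empty, Nat.cast_zero]
      positivity
  have hbi : ∀ (s : Finset ℤ) (t : ℤ → Finset (ℤ × ℤ × ℤ)) (b n : ℝ), 0 ≤ b → (s.card : ℝ) ≤ n →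
      (∀ i ∈ s, ((t i).card : ℝ) ≤ b) → ((s.biUnion t).card : ℝ) ≤ n * b := by
    intro s t b n hb hn h
    calc ((s.biUnion t).card : ℝ) ≤ ∑ i ∈ s, ((t i).card : ℝ) := by
          exact_mod_cast Finset.card_biUnion_le
      _ ≤ s.card • b := Finset.sum_le_card_nsmul _ _ _ h
      _ ≤ n * b := by rw [nsmul_eq_mul]; gcongr
  have hcard : (S.card : ℝ) ≤ E * (4 * (B - A + 3) * (2 * (C + c₂) + 1) * E) := by
    refine (Nat.cast_le.2 (Finset.card_le_card hsub)).trans ?_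
    refine hbi _ _ _ _ ?_ ?_ ?_
    · have : 0 ≤ B - A + 3 := by linarith
      positivity
    · rw [Int.card_Icc, add_sub_cancel_right]
      have h0 : 0 ≤ ⌊E⌋ := Int.floor_nonneg.2 hE0
      have : (((⌊E⌋).toNat : ℤ) : ℝ) = (⌊E⌋ : ℝ) := by rw [Int.toNat_of_nonneg h0]
      rw [Int.cast_natCast] at this
      rw [this]
      exact Int.floor_le E
    intro w hw
    rw [Finset.mem_Icc, Int.le_floor] at hw
    have hw1 : (1 : ℝ) ≤ w := by exact_mod_cast hw.1
    have hw0 : (0 : ℝ) < w := by linarith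
    have : 4 * (B - A + 3) * (2 * (C + c₂) + 1) * E =
      ((B - A + 3) * w) * ((2 * (C + c₂) + 1) * (4 * E / w)) := by field_simp
    rw [this]
    refine hbi _ _ _ _ (by positivity) ?_ ?_
    · refine (card_Icc_ceil_floor_le (by nlinarith)).trans ?_
      nlinarith
    intro u _
    refine hbi _ _ _ _ (by positivity) ?_ ?_
    · refine (card_Icc_ceil_floor_le (by linarith)).trans (le_of_eq (by ring))
    intro v _
    exact line u v w hw.1 hw.2
  refine hcard.trans (le_of_eq ?_)
  have hEE : E * E = C ^ 2 * (τ * Q ^ 4) := by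
    rw [hE]
    have := Real.mul_self_sqrt hτ
    linear_combination C ^ 2 * Q ^ 4 * this
  linear_combination (4 * (B - A + 3) * (2 * (C + c₂) + 1)) * hEE

lemma exists_card_nearTangent_le (hf : QuadraticDeviation c₁ c₂ f p) (hc : 0 < c₁)
    (hX : ∀ s, p (X s) = s) {A B : ℝ} (hAB : A ≤ B) :
    ∃ C : ℝ, 0 < C ∧ ∀ Q τ : ℝ, 1 ≤ Q → 0 ≤ τ → 8 * (c₂ + 1) * (τ * Q ^ 2) ≤ 1 →
      ∀ S : Finset (ℤ × ℤ × ℤ), (∀ j ∈ S, IsNearTangent f X Q τ j ∧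
        A ≤ stationaryPoint X j ∧ stationaryPoint X j ≤ B) →
      (S.card : ℝ) ≤ C * (Q + τ * Q ^ 4) := by
  classical
  have hc₂ : 0 < c₂ := hc.trans_le hf.le
  set K := 4 * (B - A + 3) * (2 * (2 * c₂ / √c₁ + c₂) + 1) * (2 * c₂ / √c₁) ^ 2 with hK
  have hBA : 0 ≤ B - A := by linarith
  have hK0 : 0 < K := by positivity
  obtain ⟨κ, hκ⟩ : ∃ κ, κ = 1 / (8 * (c₂ + 1)) := ⟨_, rfl⟩
  have hκ0 : 0 < κ := by rw [hκ]; positivity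
  have hκc : 8 * (c₂ + 1) * κ = 1 := by rw [hκ]; field_simp
  have hκ8 : κ ≤ 1 / 8 := by nlinarith
  refine ⟨2 * ((B - A) / κ + 2) + K, by positivity, ?_⟩
  intro Q τ hQ hτ hτQ S hS
  have hQ0 : 0 < Q := by linarith
  have hτκ : τ * Q ^ 2 ≤ κ := by
    have : 8 * (c₂ + 1) * (τ * Q ^ 2) ≤ 8 * (c₂ + 1) * κ := hτQ.trans_eq hκc.symm
    exact le_of_mul_le_mul_left this (by positivity)
  have hτQ' : 2 * τ * Q ^ 2 < 1 := by linarith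
  let cell : ℤ × ℤ × ℤ → ℤ := fun j => ⌊stationaryPoint X j * (Q / κ)⌋
  let rich : ℤ × ℤ × ℤ → Prop := fun j => 2 < (S.filter fun k => cell k = cell j).card
  have hrich : ((S.filter rich).card : ℝ) ≤ K * (τ * Q ^ 4) := by
    refine card_rich_le hf hc hX hAB hQ hτ hτQ' _ (fun j hj => (hS j (Finset.mem_filter.1 hj).1).1)
      ?_
    intro j hj
    rw [Finset.mem_filter] at hj
    obtain ⟨u, v, w, hw, hl, hline, hwE, ⟨k, hk, hkw⟩, hv⟩ :=
      IsNearTangent.exists_common_point hf hc hX hQ hκ0 hκc.le hτ hτκ _ hj.2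
        (fun k hk => (hS k (Finset.mem_filter.1 hk).1).1) (by
          intro k hk l hl
          have e : cell l = cell k :=
            (Finset.mem_filter.1 hl).2.trans (Finset.mem_filter.1 hk).2.symm
          have h := Int.abs_sub_lt_one_of_floor_eq_floor e
          rw [← sub_mul, abs_mul, abs_of_pos (div_pos hQ0 hκ0), ← lt_div_iff₀ (by positivity),
            one_div_div] at h
          exact h.le)
    have hw' : (0 : ℝ) < w := Int.cast_pos.2 hw
    obtain ⟨hkA, hkB⟩ := (hS k (Finset.mem_filter.1 hk).1).2
    have hkw' : |stationaryPoint X k * w - u| ≤ 1 := by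
      have e : stationaryPoint X k * w - u = (stationaryPoint X k - u / w) * w := by field_simp
      rw [e, abs_mul, abs_of_pos hw']
      calc _ ≤ 1 / (w : ℝ) * w := by gcongr
        _ = 1 := by field_simp
    rw [abs_le] at hkw'
    refine ⟨u, v, w, hw, hl, hline j (by simpa using hj.1), hwE, ?_, ?_, hv⟩
    · nlinarith
    · nlinarith
  have hpoor : ((S.filter fun j => ¬ rich j).card : ℝ) ≤ 2 * (((B - A) / κ + 2) * Q) := by
    have h1 : (S.filter fun j => ¬ rich j).card ≤
        2 * ((S.filter fun j => ¬ rich j).image cell).card := by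
      apply Finset.card_le_mul_card_image
      intro b hb
      obtain ⟨j, hj, rfl⟩ := Finset.mem_image.1 hb
      have hj2 := not_lt.1 (Finset.mem_filter.1 hj).2
      refine le_trans (Finset.card_le_card ?_) hj2
      exact Finset.filter_subset_filter _ (Finset.filter_subset _ _)
    have h2 : ((S.filter fun j => ¬ rich j).image cell) ⊆
        Finset.Icc ⌈A * (Q / κ) - 1⌉ ⌊B * (Q / κ)⌋ := by
      intro b hb
      obtain ⟨j, hj, rfl⟩ := Finset.mem_image.1 hb
      obtain ⟨hA, hB⟩ := (hS j (Finset.mem_filter.1 hj).1).2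
      have hpos : 0 < Q / κ := by positivity
      rw [Finset.mem_Icc]
      constructor
      · apply Int.ceil_le.2
        have := Int.lt_floor_add_one (stationaryPoint X j * (Q / κ))
        have : A * (Q / κ) ≤ stationaryPoint X j * (Q / κ) := by gcongr
        simp only [cell]
        linarith
      · exact Int.floor_le_floor (by gcongr)
    have h3 : A * (Q / κ) ≤ B * (Q / κ) := by gcongr
    have h4 := card_Icc_ceil_floor_le (α := A * (Q / κ) - 1) (β := B * (Q / κ)) (by linarith)
    calc ((S.filter fun j => ¬ rich j).card : ℝ)
        ≤ 2 * (((S.filter fun j => ¬ rich j).image cell).card : ℝ) := by exact_mod_cast h1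
      _ ≤ 2 * ((Finset.Icc ⌈A * (Q / κ) - 1⌉ ⌊B * (Q / κ)⌋).card : ℝ) := by
        gcongr
      _ ≤ 2 * (B * (Q / κ) - (A * (Q / κ) - 1) + 1) := by gcongr
      _ = 2 * ((B - A) / κ * Q + 2) := by ring
      _ ≤ _ := by nlinarith
  rw [← Finset.card_filter_add_card_filter_not rich]
  push_cast
  have : 0 ≤ K * Q := by positivity
  have : 0 ≤ 2 * ((B - A) / κ + 2) * (τ * Q ^ 4) := by positivity
  nlinarith

lemma sum_Icc_one_div_pow_four_le (n : ℕ) : ∑ m ∈ Finset.Icc 1 n, 1 / (m : ℝ) ^ 4 ≤ 2 := by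
  suffices h : ∑ m ∈ Finset.Icc 1 n, 1 / (m : ℝ) ^ 4 ≤ 2 - 2 / ((n : ℝ) + 1) by
    have : (0 : ℝ) ≤ 2 / ((n : ℝ) + 1) := by positivity
    linarith
  induction n with
  | zero => norm_num
  | succ k ih =>
    rw [Finset.sum_Icc_succ_top (by omega)]
    push_cast
    have h : 1 / ((k : ℝ) + 1) ^ 4 ≤ 2 / ((k : ℝ) + 1) - 2 / ((k : ℝ) + 1 + 1) := by
      have e : 2 / ((k : ℝ) + 1) - 2 / ((k : ℝ) + 1 + 1) = 2 / (((k : ℝ) + 1) * (k + 2)) := by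
        field_simp
        ring
      rw [e, div_le_div_iff₀ (by positivity) (by positivity)]
      have : (0 : ℝ) ≤ k := Nat.cast_nonneg k
      nlinarith [mul_nonneg this this, pow_nonneg this 3, pow_nonneg this 4]
    linarith

/-- Pairs `(a, q)` whose form `a x + q f x` has its stationary point in `[A, B]`. -/
lemma card_pairs_le (hf : QuadraticDeviation c₁ c₂ f p) (hc : 0 < c₁)
    (hX : ∀ s, p (X s) = s) {A B : ℝ} {Q : ℕ} (hQ : 1 ≤ Q) (S : Finset (ℤ × ℤ))
    (hS : ∀ j ∈ S, 0 < j.2 ∧ j.2 ≤ Q ∧ A ≤ X (-((j.1 : ℝ) / j.2)) ∧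
      X (-((j.1 : ℝ) / j.2)) ≤ B) :
    (S.card : ℝ) ≤ (2 * (|p A| + |p B|) + 1) * (Q : ℝ) ^ 2 := by
  set M := |p A| + |p B| with hM
  have hM0 : 0 ≤ M := by positivity
  have hQ1 : (1 : ℝ) ≤ Q := by exact_mod_cast hQ
  have hsub : S ⊆ Finset.Icc ⌈-(M * Q)⌉ ⌊M * Q⌋ ×ˢ Finset.Icc 1 (Q : ℤ) := by
    intro j hj
    obtain ⟨h0, h1, h2, h3⟩ := hS j hj
    have hq : (0 : ℝ) < j.2 := Int.cast_pos.2 h0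
    have hqQ : (j.2 : ℝ) ≤ Q := by exact_mod_cast h1
    have l1 := hf.slope_lower h2
    have l2 := hf.slope_lower h3
    rw [hX] at l1 l2
    have k1 : 0 ≤ c₁ * (X (-((j.1 : ℝ) / j.2)) - A) := mul_nonneg hc.le (by linarith)
    have k2 : 0 ≤ c₁ * (B - X (-((j.1 : ℝ) / j.2))) := mul_nonneg hc.le (by linarith)
    have m1 := neg_abs_le (p A)
    have m2 := le_abs_self (p B)
    have n1 := abs_nonneg (p A)
    have n2 := abs_nonneg (p B)
    have b : |(j.1 : ℝ) / j.2| ≤ M := by rw [abs_le]; constructor <;> linarith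
    rw [abs_div, abs_of_pos hq, div_le_iff₀ hq] at b
    have b' : |(j.1 : ℝ)| ≤ M * Q := b.trans (by gcongr)
    rw [abs_le] at b'
    rw [Finset.mem_product, Finset.mem_Icc, Finset.mem_Icc]
    exact ⟨⟨Int.ceil_le.2 b'.1, Int.le_floor.2 b'.2⟩, h0, h1⟩
  have hMQ : 0 ≤ M * Q := by positivity
  have h1 := card_Icc_ceil_floor_le (α := -(M * Q)) (β := M * Q) (by linarith)
  have h2 : (S.card : ℝ) ≤ (M * Q - -(M * Q) + 1) * Q := by
    refine (Nat.cast_le.2 (Finset.card_le_card hsub)).trans ?_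
    rw [Finset.card_product]
    push_cast
    gcongr
    · linarith
    · simp
  nlinarith

/-- Pairs `(a, q)` whose form `a x + q f x` has a stationary value close to an integer. -/
lemma exists_card_pairs_le (hf : QuadraticDeviation c₁ c₂ f p) (hc : 0 < c₁)
    (hX : ∀ s, p (X s) = s) {A B : ℝ} (hAB : A ≤ B) :
    ∃ C : ℝ, 0 < C ∧ ∀ (Q : ℕ) (τ : ℝ), 1 ≤ Q → 0 ≤ τ →
      ∀ S : Finset (ℤ × ℤ), (∀ j ∈ S, 0 < j.2 ∧ j.2 ≤ Q ∧ A ≤ X (-((j.1 : ℝ) / j.2)) ∧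
        X (-((j.1 : ℝ) / j.2)) ≤ B ∧
        nint (j.1 * X (-((j.1 : ℝ) / j.2)) + j.2 * f (X (-((j.1 : ℝ) / j.2)))) ≤ τ * j.2) →
      (S.card : ℝ) ≤ C * (Q * (1 + Real.log Q) + τ * Q ^ 4) := by
  classical
  have hc₂ : 0 < c₂ := hc.trans_le hf.le
  obtain ⟨C, hC, hprim⟩ := exists_card_nearTangent_le hf hc hX hAB
  set M := |p A| + |p B| with hM
  have hM0 : 0 ≤ M := by positivity
  refine ⟨2 * C + (2 * M + 1) * (8 * (c₂ + 1)), by positivity, ?_⟩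
  intro Q τ hQ hτ S hS
  have hQ1 : (1 : ℝ) ≤ Q := by exact_mod_cast hQ
  have hQ0 : (0 : ℝ) < Q := by linarith
  have hlog : 0 ≤ Real.log Q := Real.log_nonneg hQ1
  have hT1 : 0 ≤ C * (Q * (1 + Real.log Q)) := by positivity
  have hT2 : 0 ≤ C * (τ * (Q : ℝ) ^ 4) := by positivity
  have hT3 : 0 ≤ (2 * M + 1) * (8 * (c₂ + 1)) * (Q * (1 + Real.log Q)) := by positivity
  have hT4 : 0 ≤ (2 * M + 1) * (8 * (c₂ + 1)) * (τ * (Q : ℝ) ^ 4) := by positivity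
  rcases lt_or_ge 1 (8 * (c₂ + 1) * (τ * (Q : ℝ) ^ 2)) with hbig | hsmall
  · have h3 := card_pairs_le hf hc hX (A := A) (B := B) hQ S fun j hj =>
      ⟨(hS j hj).1, (hS j hj).2.1, (hS j hj).2.2.1, (hS j hj).2.2.2.1⟩
    have h4 : (Q : ℝ) ^ 2 ≤ 8 * (c₂ + 1) * (τ * (Q : ℝ) ^ 4) := by
      have : (0 : ℝ) < (Q : ℝ) ^ 2 := by positivity
      nlinarith
    have h5 : (2 * M + 1) * (Q : ℝ) ^ 2 ≤ (2 * M + 1) * (8 * (c₂ + 1) * (τ * (Q : ℝ) ^ 4)) := by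
      gcongr
    nlinarith
  · have hex : ∀ j ∈ S, ∃ (m : ℕ) (k : ℤ × ℤ × ℤ), 0 < m ∧ j.1 = m * k.1 ∧ j.2 = m * k.2.1 ∧
        -round (j.1 * X (-((j.1 : ℝ) / j.2)) + j.2 * f (X (-((j.1 : ℝ) / j.2)))) = m * k.2.2 ∧
        IsPrimitive k.1 k.2.1 k.2.2 := by
      intro j hj
      obtain ⟨m, a, b, c, hm, h1, h2, h3, h4⟩ := exists_primitive j.1 j.2
        (-round (j.1 * X (-((j.1 : ℝ) / j.2)) + j.2 * f (X (-((j.1 : ℝ) / j.2)))))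
        (Or.inr (Or.inl (hS j hj).1.ne'))
      lift m to ℕ using hm.le
      exact ⟨m, (a, b, c), by exact_mod_cast hm, h1, h2, h3, h4⟩
    choose! m k hm h1 h2 h3 h4 using hex
    have hmaps : ∀ j ∈ S, m j ∈ Finset.Icc 1 Q := by
      intro j hj
      rw [Finset.mem_Icc]
      refine ⟨hm j hj, ?_⟩
      obtain ⟨hq, hqQ, -⟩ := hS j hj
      have : (m j : ℤ) ≤ j.2 := Int.le_of_dvd hq ⟨_, h2 j hj⟩
      exact_mod_cast this.trans hqQ
    have hfib : ∀ n ∈ Finset.Icc 1 Q, ((S.filter fun j => m j = n).card : ℝ) ≤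
        C * (Q / n + τ * (Q / n) ^ 4) := by
      intro n hn
      rw [Finset.mem_Icc] at hn
      have hn0 : (0 : ℝ) < n := by exact_mod_cast hn.1
      have hn1 : (1 : ℝ) ≤ n := by exact_mod_cast hn.1
      have hnQ : (n : ℝ) ≤ Q := by exact_mod_cast hn.2
      have hinj : Set.InjOn k (S.filter fun j => m j = n : Finset (ℤ × ℤ)) := by
        intro i hi j hj hij
        rw [Finset.mem_coe, Finset.mem_filter] at hi hj
        apply Prod.ext
        · rw [h1 i hi.1, h1 j hj.1, hi.2, hj.2, hij]
        · rw [h2 i hi.1, h2 j hj.1, hi.2, hj.2, hij]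
      rw [← Finset.card_image_of_injOn hinj]
      have hQn : (Q : ℝ) / n ≤ Q := div_le_self hQ0.le hn1
      apply hprim _ _ (by rwa [le_div_iff₀ hn0, one_mul]) hτ
      · refine le_trans ?_ hsmall
        gcongr
      intro l hl
      obtain ⟨j, hj, rfl⟩ := Finset.mem_image.1 hl
      rw [Finset.mem_filter] at hj
      obtain ⟨hj, rfl⟩ := hj
      obtain ⟨hq, hqQ, hA, hB, hnear⟩ := hS j hj
      have e1 : (j.1 : ℝ) = m j * (k j).1 := by exact_mod_cast h1 j hj
      have e2 : (j.2 : ℝ) = m j * (k j).2.1 := by exact_mod_cast h2 j hj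
      have e3 : -(round (j.1 * X (-((j.1 : ℝ) / j.2)) + j.2 * f (X (-((j.1 : ℝ) / j.2)))) : ℝ) =
        m j * (k j).2.2 := by exact_mod_cast h3 j hj
      have ex : X (-((j.1 : ℝ) / j.2)) = stationaryPoint X (k j) := by
        unfold stationaryPoint
        rw [e1, e2, mul_div_mul_left _ _ hn0.ne']
      have hqR : (j.2 : ℝ) ≤ Q := by exact_mod_cast hqQ
      rw [ex] at hA hB hnear e3
      refine ⟨⟨h4 j hj, ?_, ?_, ?_⟩, hA, hB⟩
      · rw [h2 j hj] at hq
        exact pos_of_mul_pos_right hq (by positivity)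
      · rw [le_div_iff₀ hn0, mul_comm, ← e2]
        exact hqR
      · have e : (j.1 * stationaryPoint X (k j) + j.2 * f (stationaryPoint X (k j))) -
            round (j.1 * stationaryPoint X (k j) + j.2 * f (stationaryPoint X (k j)) : ℝ) =
            m j * stationaryValue f X (k j) := by
          unfold stationaryValue
          rw [sub_eq_add_neg, e3, e1, e2]
          ring
        rw [nint, e, abs_mul, abs_of_pos hn0, e2] at hnear
        refine le_of_mul_le_mul_left ?_ hn0
        linarith
    rw [Finset.card_eq_sum_card_fiberwise hmaps]
    push_cast
    have hharm : ∑ n ∈ Finset.Icc 1 Q, 1 / (n : ℝ) ≤ 1 + Real.log Q := by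
      have := harmonic_le_one_add_log Q
      rw [harmonic_eq_sum_Icc] at this
      push_cast at this
      simpa [one_div] using this
    calc ∑ n ∈ Finset.Icc 1 Q, ((S.filter fun j => m j = n).card : ℝ)
        ≤ ∑ n ∈ Finset.Icc 1 Q, C * (Q / n + τ * (Q / n) ^ 4) := Finset.sum_le_sum hfib
      _ = C * (Q * ∑ n ∈ Finset.Icc 1 Q, 1 / (n : ℝ) +
          τ * Q ^ 4 * ∑ n ∈ Finset.Icc 1 Q, 1 / (n : ℝ) ^ 4) := by
        rw [Finset.mul_sum, Finset.mul_sum, ← Finset.sum_add_distrib, Finset.mul_sum]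
        refine Finset.sum_congr rfl fun n _ => ?_
        rw [div_pow]
        ring
      _ ≤ C * (Q * (1 + Real.log Q) + τ * Q ^ 4 * 2) := by
        gcongr
        exact sum_Icc_one_div_pow_four_le Q
      _ ≤ _ := by nlinarith

end Counting

/-- Measure of the points of `[ξ, η]` at which `G` is within `lam` of an integer. -/
noncomputable def nearMeasure (ξ η lam : ℝ) (G : ℝ → ℝ) : ℝ :=
  volume.real {x ∈ Icc ξ η | nint (G x) < lam}

lemma nint_neg (y : ℝ) : nint (-y) = nint y := by
  unfold nint
  apply le_antisymm
  · refine (round_le (-y) (-round y)).trans (le_of_eq ?_)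
    rw [← abs_neg]
    push_cast
    ring_nf
  · refine (round_le y (-round (-y))).trans (le_of_eq ?_)
    rw [← abs_neg]
    push_cast
    ring_nf

lemma nearMeasure_neg (ξ η lam : ℝ) (G : ℝ → ℝ) :
    nearMeasure ξ η lam (fun x => -G x) = nearMeasure ξ η lam G := by
  simp only [nearMeasure, nint_neg]

lemma nearMeasure_le_length {ξ η : ℝ} (h : ξ ≤ η) (lam : ℝ) (G : ℝ → ℝ) :
    nearMeasure ξ η lam G ≤ η - ξ := by
  rw [← Real.volume_real_Icc_of_le h]
  exact measureReal_mono (sep_subset _ _) measure_Icc_lt_top.ne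

lemma nearMeasure_le_sum {ι : Type*} {ξ η lam : ℝ} {G : ℝ → ℝ} (T : Finset ι) (s : ι → Set ℝ)
    (hs : ∀ i, s i ⊆ Icc ξ η)
    (h : ∀ x ∈ Icc ξ η, ∀ n : ℤ, |G x - n| < lam → ∃ i ∈ T, x ∈ s i) :
    nearMeasure ξ η lam G ≤ ∑ i ∈ T, volume.real (s i) := by
  refine (measureReal_mono ?_ ?_).trans (measureReal_biUnion_finset_le T s)
  · intro x hx
    obtain ⟨i, hi, hxi⟩ := h x hx.1 _ hx.2
    exact mem_biUnion hi hxi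
  · exact ne_top_of_le_ne_top measure_Icc_lt_top.ne (measure_mono (iUnion₂_subset fun i _ => hs i))

lemma volume_real_le_of_sub_le {s : Set ℝ} {d : ℝ} (hd : 0 ≤ d)
    (h : ∀ x ∈ s, ∀ y ∈ s, x ≤ y → y - x ≤ d) : volume.real s ≤ d := by
  refine ENNReal.toReal_le_of_le_ofReal hd ((Real.volume_le_diam s).trans ?_)
  refine Metric.ediam_le fun x hx y hy => ?_
  rw [edist_dist, Real.dist_eq]
  apply ENNReal.ofReal_le_ofReal
  rcases le_total x y with hxy | hxy
  · rw [abs_of_nonpos (by linarith), neg_sub]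
    exact h x hx y hy hxy
  · rw [abs_of_nonneg (by linarith)]
    exact h y hy x hx hxy

lemma volume_real_le_of_sides {s : Set ℝ} {d z : ℝ} (hd : 0 ≤ d)
    (hr : ∀ x ∈ s, ∀ y ∈ s, z ≤ x → x ≤ y → y - x ≤ d)
    (hl : ∀ x ∈ s, ∀ y ∈ s, y ≤ x → x ≤ z → x - y ≤ d) : volume.real s ≤ 2 * d := by
  have e : s = {x ∈ s | z ≤ x} ∪ {x ∈ s | x ≤ z} := by
    ext x
    have := le_total z x
    simp only [mem_union, mem_sep_iff]
    tauto
  rw [e]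
  refine (measureReal_union_le _ _).trans ?_
  have h1 : volume.real {x ∈ s | z ≤ x} ≤ d :=
    volume_real_le_of_sub_le hd fun x hx y hy hxy => hr x hx.1 y hy.1 hx.2 hxy
  have h2 : volume.real {x ∈ s | x ≤ z} ≤ d :=
    volume_real_le_of_sub_le hd fun x hx y hy hxy => hl y hy.1 x hx.1 hxy hy.2
  linarith

lemma nearMeasure_le_of_expanding {ξ η lam κ D : ℝ} {G : ℝ → ℝ} (hξη : ξ ≤ η) (hlam : 0 < lam)
    (hlam' : lam < 1 / 2) (hD : 0 < D) (hκ : 0 ≤ κ)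
    (hl : ∀ x ∈ Icc ξ η, ∀ y ∈ Icc ξ η, x ≤ y → D * (y - x) ≤ |G y - G x|)
    (hu : ∀ x ∈ Icc ξ η, ∀ y ∈ Icc ξ η, x ≤ y → |G y - G x| ≤ κ * D * (y - x)) :
    nearMeasure ξ η lam G ≤ (4 * κ * (η - ξ) + 4 / D) * lam := by
  have hL : 0 ≤ η - ξ := by linarith
  have hR : 0 ≤ κ * D * (η - ξ) := by positivity
  refine (nearMeasure_le_sum (Finset.Icc ⌈G ξ - κ * D * (η - ξ) - 1 / 2⌉
    ⌊G ξ + κ * D * (η - ξ) + 1 / 2⌋) (fun n : ℤ => {x ∈ Icc ξ η | |G x - n| < lam})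
    (fun _ => sep_subset _ _) ?_).trans ?_
  · intro x hx n hn
    refine ⟨n, ?_, hx, hn⟩
    have h1 := hu ξ (left_mem_Icc.2 hξη) x hx hx.1
    have h2 : κ * D * (x - ξ) ≤ κ * D * (η - ξ) := by
      have := hx.2
      gcongr
    rw [abs_le] at h1
    rw [abs_lt] at hn
    rw [Finset.mem_Icc]
    exact ⟨Int.ceil_le.2 (by linarith), Int.le_floor.2 (by linarith)⟩
  · have hlev : ∀ n : ℤ, volume.real {x ∈ Icc ξ η | |G x - n| < lam} ≤ 2 * lam / D := by
      intro n
      refine volume_real_le_of_sub_le (by positivity) ?_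
      rintro x ⟨hx, hxn⟩ y ⟨hy, hyn⟩ hxy
      rw [le_div_iff₀ hD, mul_comm]
      refine (hl x hx y hy hxy).trans ?_
      rw [abs_lt] at hxn hyn
      rw [abs_le]
      constructor <;> linarith
    refine (Finset.sum_le_card_nsmul _ _ _ fun n _ => hlev n).trans ?_
    rw [nsmul_eq_mul]
    have hcard := card_Icc_ceil_floor_le (α := G ξ - κ * D * (η - ξ) - 1 / 2)
      (β := G ξ + κ * D * (η - ξ) + 1 / 2) (by linarith)
    calc _ ≤ (2 * (κ * D * (η - ξ)) + 2) * (2 * lam / D) := by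
          gcongr
          linarith
      _ = _ := by
          field_simp
          ring

lemma sum_Icc_one_div_sqrt_le (n : ℕ) : ∑ k ∈ Finset.Icc 1 n, 1 / √(k : ℝ) ≤ 2 * √(n : ℝ) := by
  induction n with
  | zero => simp
  | succ k ih =>
    rw [Finset.sum_Icc_succ_top (by omega)]
    push_cast
    have hk : (0 : ℝ) ≤ k := Nat.cast_nonneg k
    have h1 : 0 < √((k : ℝ) + 1) := Real.sqrt_pos.2 (by positivity)
    have h0 : 0 ≤ √(k : ℝ) := Real.sqrt_nonneg _
    have e1 := Real.sq_sqrt hk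
    have e2 := Real.sq_sqrt (show (0 : ℝ) ≤ (k : ℝ) + 1 by positivity)
    have : 1 / √((k : ℝ) + 1) ≤ 2 * √((k : ℝ) + 1) - 2 * √(k : ℝ) := by
      rw [div_le_iff₀ h1]
      nlinarith [sq_nonneg (√((k : ℝ) + 1) - √(k : ℝ))]
    linarith

section Forms

variable {c₁ c₂ : ℝ} {f p X : ℝ → ℝ}

/-- A form whose stationary point is at distance at least `1` from the interval. -/
lemma nearMeasure_le_of_far (hf : QuadraticDeviation c₁ c₂ f p) (hc : 0 < c₁) {ξ η lam z : ℝ}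
    (hξη : ξ ≤ η) (hlam : 0 < lam) (hlam' : lam < 1 / 2) {a q : ℝ} (hq : 1 ≤ q)
    (hz : p z = -(a / q)) (hfar : z ≤ ξ - 1 ∨ η + 1 ≤ z) :
    nearMeasure ξ η lam (fun x => a * x + q * f x) ≤
      (4 * (c₂ * (1 + (η - ξ)) / c₁) * (η - ξ) + 4 / c₁) * lam := by
  have hc₂ : 0 < c₂ := hc.trans_le hf.le
  have hq0 : 0 < q := by linarith
  have hL : 0 ≤ η - ξ := by linarith
  have key : ∀ x y, (a * y + q * f y) - (a * x + q * f x) =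
      q * (f y - f x - p z * (y - x)) := by
    intro x y
    rw [hz]
    field_simp
    ring
  have hsec : ∀ x y, x ≤ y → (p x - p z) * (y - x) ≤ f y - f x - p z * (y - x) ∧
      f y - f x - p z * (y - x) ≤ (p y - p z) * (y - x) := by
    intro x y _
    have h1 := (hf x y).1
    have h2 := (hf y x).1
    constructor <;> nlinarith [sq_nonneg (y - x)]
  suffices h : ∃ d, 1 ≤ d ∧ ∀ x ∈ Icc ξ η, ∀ y ∈ Icc ξ η, x ≤ y →
      c₁ * d * (y - x) ≤ |f y - f x - p z * (y - x)| ∧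
        |f y - f x - p z * (y - x)| ≤ c₂ * (d + (η - ξ)) * (y - x) by
    obtain ⟨d, hd, h⟩ := h
    have hd0 : 0 < d := by linarith
    refine (nearMeasure_le_of_expanding (D := q * (c₁ * d)) (κ := c₂ * (1 + (η - ξ)) / c₁) hξη hlam
      hlam' (by positivity) (by positivity) ?_ ?_).trans ?_
    · intro x hx y hy hxy
      rw [key, abs_mul, abs_of_pos hq0, mul_assoc]
      exact mul_le_mul_of_nonneg_left (h x hx y hy hxy).1 hq0.le
    · intro x hx y hy hxy
      rw [key, abs_mul, abs_of_pos hq0]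
      have h1 : c₂ * (d + (η - ξ)) * (y - x) ≤ c₂ * ((1 + (η - ξ)) * d) * (y - x) := by
        have : 0 ≤ y - x := by linarith
        gcongr
        nlinarith
      calc q * |f y - f x - p z * (y - x)| ≤ q * (c₂ * ((1 + (η - ξ)) * d) * (y - x)) := by
            gcongr
            exact (h x hx y hy hxy).2.trans h1
        _ = _ := by
            field_simp
    · gcongr
      have : c₁ * 1 ≤ c₁ * d := by gcongr
      nlinarith
  rcases hfar with hfar | hfar
  · refine ⟨ξ - z, by linarith, fun x hx y hy hxy => ?_⟩
    obtain ⟨h1, h2⟩ := hsec x y hxy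
    have hyx : 0 ≤ y - x := by linarith
    have h3 := hf.slope_lower (show z ≤ x by linarith [hx.1])
    have h4 := hf.slope_upper (show z ≤ y by linarith [hy.1])
    have h5 : c₁ * (ξ - z) ≤ c₁ * (x - z) := by gcongr; exact hx.1
    have h6 : c₂ * (y - z) ≤ c₂ * (ξ - z + (η - ξ)) := by gcongr; linarith [hy.2]
    have h7 : c₁ * (ξ - z) * (y - x) ≤ (p x - p z) * (y - x) := by gcongr; linarith
    have h8 : (p y - p z) * (y - x) ≤ c₂ * (ξ - z + (η - ξ)) * (y - x) := by gcongr; linarith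
    have h9 : 0 ≤ c₁ * (ξ - z) * (y - x) :=
      mul_nonneg (mul_nonneg hc.le (by linarith)) hyx
    rw [abs_of_nonneg (by linarith)]
    constructor <;> linarith
  · refine ⟨z - η, by linarith, fun x hx y hy hxy => ?_⟩
    obtain ⟨h1, h2⟩ := hsec x y hxy
    have hyx : 0 ≤ y - x := by linarith
    have h3 := hf.slope_lower (show y ≤ z by linarith [hy.2])
    have h4 := hf.slope_upper (show x ≤ z by linarith [hx.2])
    have h5 : c₁ * (z - η) ≤ c₁ * (z - y) := by gcongr; exact hy.2
    have h6 : c₂ * (z - x) ≤ c₂ * (z - η + (η - ξ)) := by gcongr; linarith [hx.1]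
    have h7 : c₁ * (z - η) * (y - x) ≤ (p z - p y) * (y - x) := by gcongr; linarith
    have h8 : (p z - p x) * (y - x) ≤ c₂ * (z - η + (η - ξ)) * (y - x) := by gcongr; linarith
    have h9 : 0 ≤ c₁ * (z - η) * (y - x) :=
      mul_nonneg (mul_nonneg hc.le (by linarith)) hyx
    rw [abs_of_nonpos (by linarith)]
    constructor <;> linarith

/-- Growth of `f` minus its tangent at `z`, moving away from `z`. -/
lemma QuadraticDeviation.growth (hf : QuadraticDeviation c₁ c₂ f p) {x y z : ℝ}
    (hside : (z ≤ x ∧ x ≤ y) ∨ (y ≤ x ∧ x ≤ z)) :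
    c₁ / 2 * (y - x) ^ 2 + c₁ * (|x - z| * |y - x|) ≤
      (f y - f z - p z * (y - z)) - (f x - f z - p z * (x - z)) := by
  have h1 := (hf x y).1
  have h2 : c₁ * (|x - z| * |y - x|) ≤ (p x - p z) * (y - x) := by
    rcases hside with ⟨ha, hb⟩ | ⟨ha, hb⟩
    · rw [abs_of_nonneg (by linarith), abs_of_nonneg (by linarith), ← mul_assoc]
      have := hf.slope_lower ha
      gcongr
    · rw [abs_of_nonpos (by linarith), abs_of_nonpos (by linarith)]
      have := hf.slope_lower hb
      nlinarith
  linarith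

lemma volume_level_le (hf : QuadraticDeviation c₁ c₂ f p) (hc : 0 < c₁) {q lam : ℝ} (hq : 0 < q)
    (hlam : 0 < lam) (ξ η z e : ℝ) :
    volume.real {x ∈ Icc ξ η | |q * (f x - f z - p z * (x - z)) + e| < lam} ≤
      2 * √(4 * lam / (c₁ * q)) := by
  have main : ∀ x y, |q * (f x - f z - p z * (x - z)) + e| < lam →
      |q * (f y - f z - p z * (y - z)) + e| < lam → (z ≤ x ∧ x ≤ y) ∨ (y ≤ x ∧ x ≤ z) →
      (y - x) ^ 2 ≤ 4 * lam / (c₁ * q) := by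
    intro x y hx hy hside
    have h1 := hf.growth hside
    have h2 : 0 ≤ c₁ * (|x - z| * |y - x|) := by positivity
    rw [abs_lt] at hx hy
    rw [le_div_iff₀ (by positivity)]
    nlinarith
  refine volume_real_le_of_sides (z := z) (by positivity) ?_ ?_
  · rintro x ⟨-, hx⟩ y ⟨-, hy⟩ hzx hxy
    exact Real.le_sqrt_of_sq_le (main x y hx hy (Or.inl ⟨hzx, hxy⟩))
  · rintro x ⟨-, hx⟩ y ⟨-, hy⟩ hzx hxy
    apply Real.le_sqrt_of_sq_le
    rw [← neg_sub, neg_sq]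
    exact main x y hx hy (Or.inr ⟨hzx, hxy⟩)

lemma volume_level_le_of_dist (hf : QuadraticDeviation c₁ c₂ f p) (hc : 0 < c₁) {q lam r : ℝ}
    (hq : 0 < q) (hlam : 0 < lam) (hr : 0 < r) (ξ η z e : ℝ)
    (h : ∀ x ∈ Icc ξ η, |q * (f x - f z - p z * (x - z)) + e| < lam → r ^ 2 ≤ (x - z) ^ 2) :
    volume.real {x ∈ Icc ξ η | |q * (f x - f z - p z * (x - z)) + e| < lam} ≤
      2 * (2 * lam / (c₁ * q * r)) := by
  have main : ∀ x ∈ Icc ξ η, ∀ y, |q * (f x - f z - p z * (x - z)) + e| < lam →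
      |q * (f y - f z - p z * (y - z)) + e| < lam → (z ≤ x ∧ x ≤ y) ∨ (y ≤ x ∧ x ≤ z) →
      |y - x| ≤ 2 * lam / (c₁ * q * r) := by
    intro x hxI y hx hy hside
    have h1 := hf.growth hside
    have h3 : r ≤ |x - z| := by
      rw [← abs_of_pos hr]
      exact sq_le_sq.1 (h x hxI hx)
    have h4 : c₁ * (r * |y - x|) ≤ c₁ * (|x - z| * |y - x|) := by gcongr
    have h5 : 0 ≤ c₁ / 2 * (y - x) ^ 2 := by positivity
    rw [abs_lt] at hx hy
    rw [le_div_iff₀ (by positivity)]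
    nlinarith
  refine volume_real_le_of_sides (z := z) (by positivity) ?_ ?_
  · rintro x ⟨hxI, hx⟩ y ⟨-, hy⟩ hzx hxy
    exact (le_abs_self _).trans (main x hxI y hx hy (Or.inl ⟨hzx, hxy⟩))
  · rintro x ⟨hxI, hx⟩ y ⟨-, hy⟩ hzx hxy
    rw [← neg_sub]
    exact (neg_le_abs _).trans (main x hxI y hx hy (Or.inr ⟨hzx, hxy⟩))

lemma nearMeasure_le_level_zero_add (hf : QuadraticDeviation c₁ c₂ f p) (hc : 0 < c₁)
    {A B ξ η : ℝ} (hA : A ≤ ξ) (hB : η ≤ B) {lam : ℝ} (hlam : 0 < lam) (hlam' : lam ≤ 1 / 4)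
    {a q z : ℝ} (hq : 1 ≤ q) (hz : p z = -(a / q)) (hzA : A ≤ z) (hzB : z ≤ B) :
    nearMeasure ξ η lam (fun x => a * x + q * f x) ≤
      volume.real {x ∈ Icc ξ η | |q * (f x - f z - p z * (x - z)) +
        (a * z + q * f z - round (a * z + q * f z))| < lam} +
      8 * √(2 * c₂) / c₁ * √(c₂ * (B - A) ^ 2 / 2 + 1) * lam := by
  have hc₂ : 0 < c₂ := hc.trans_le hf.le
  have hq0 : 0 < q := by linarith
  set e := a * z + q * f z - round (a * z + q * f z) with he
  have he2 : |e| ≤ 1 / 2 := abs_sub_round _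
  rw [abs_le] at he2
  have hupper : ∀ x ∈ Icc ξ η, q * (f x - f z - p z * (x - z)) ≤ q * (c₂ * (B - A) ^ 2 / 2) := by
    intro x hx
    have h1 := (hf z x).2
    have h2 : (x - z) ^ 2 ≤ (B - A) ^ 2 := by
      have := hx.1
      have := hx.2
      rw [sq_le_sq, abs_of_nonneg (show 0 ≤ B - A by linarith), abs_le]
      constructor <;> linarith
    have h3 : c₂ / 2 * (x - z) ^ 2 ≤ c₂ / 2 * (B - A) ^ 2 := by gcongr
    gcongr
    linarith
  have hnonneg : ∀ x, 0 ≤ q * (f x - f z - p z * (x - z)) := by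
    intro x
    have h1 := (hf z x).1
    have : 0 ≤ c₁ / 2 * (x - z) ^ 2 := by positivity
    exact mul_nonneg hq0.le (by linarith)
  set N := ⌊q * (c₂ * (B - A) ^ 2 / 2) + 1⌋₊ with hN
  let s : ℕ → Set ℝ := fun k =>
    {x ∈ Icc ξ η | |q * (f x - f z - p z * (x - z)) + (e - k)| < lam}
  have hsum := nearMeasure_le_sum (G := fun x => a * x + q * f x) (lam := lam)
    (insert 0 (Finset.Icc 1 N)) s (ξ := ξ) (η := η) (fun _ => sep_subset _ _) (by
      intro x hx n hn
      have hG : a * x + q * f x - n = q * (f x - f z - p z * (x - z)) +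
          (e - ((n - round (a * z + q * f z) : ℤ) : ℝ)) := by
        rw [he, hz]
        push_cast
        field_simp
        ring
      rw [hG] at hn
      generalize n - round (a * z + q * f z) = k at hn
      have hn' := abs_lt.1 hn
      have h1 := hupper x hx
      have h2 := hnonneg x
      have hk0 : 0 ≤ k := by
        have : (-1 : ℝ) < k := by linarith
        have : (-1 : ℤ) < k := by exact_mod_cast this
        omega
      lift k to ℕ using hk0
      rw [Int.cast_natCast] at hn hn'
      refine ⟨k, ?_, hx, hn⟩
      rw [Finset.mem_insert, Finset.mem_Icc]
      rcases Nat.eq_zero_or_pos k with h0 | h0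
      · exact Or.inl h0
      · exact Or.inr ⟨h0, Nat.le_floor (by linarith)⟩)
  rw [Finset.sum_insert (by simp)] at hsum
  have hzero : s 0 = {x ∈ Icc ξ η | |q * (f x - f z - p z * (x - z)) + e| < lam} := by
    simp [s]
  rw [hzero] at hsum
  refine hsum.trans ((add_le_add_iff_left _).2 ?_)
  have hlev : ∀ k ∈ Finset.Icc 1 N, volume.real (s k) ≤
      4 * √(2 * c₂) / (c₁ * √q) * lam * (1 / √(k : ℝ)) := by
    intro k hk
    have hk1 : (1 : ℝ) ≤ k := by exact_mod_cast (Finset.mem_Icc.1 hk).1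
    have hk0 : (0 : ℝ) < k := by linarith
    refine (volume_level_le_of_dist hf hc hq0 hlam (r := √(k / (2 * c₂ * q)))
      (Real.sqrt_pos.2 (by positivity)) ξ η z (e - k) ?_).trans (le_of_eq ?_)
    · intro x hx hxk
      rw [Real.sq_sqrt (by positivity), div_le_iff₀ (by positivity)]
      have h1 := (hf z x).2
      have h2 := (abs_lt.1 hxk).1
      have h3 : q * (f x - f z - p z * (x - z)) ≤ q * (c₂ / 2 * (x - z) ^ 2) := by gcongr
      nlinarith
    · rw [Real.sqrt_div hk0.le, Real.sqrt_mul (by positivity) q]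
      have hs : √q ^ 2 = q := Real.sq_sqrt hq0.le
      have : 0 < √q := Real.sqrt_pos.2 hq0
      have : 0 < √(k : ℝ) := Real.sqrt_pos.2 hk0
      field_simp
      rw [hs]
      ring
  refine (Finset.sum_le_sum hlev).trans ?_
  rw [← Finset.mul_sum]
  have hNq : √(N : ℝ) ≤ √q * √(c₂ * (B - A) ^ 2 / 2 + 1) := by
    rw [← Real.sqrt_mul hq0.le]
    apply Real.sqrt_le_sqrt
    refine (Nat.floor_le (by positivity)).trans ?_
    linarith
  have hsq : 0 < √q := Real.sqrt_pos.2 hq0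
  calc _ ≤ 4 * √(2 * c₂) / (c₁ * √q) * lam * (2 * (√q * √(c₂ * (B - A) ^ 2 / 2 + 1))) := by
        gcongr
        refine (sum_Icc_one_div_sqrt_le N).trans ?_
        gcongr
    _ = _ := by
        field_simp
        ring

lemma exists_nearMeasure_le (hf : QuadraticDeviation c₁ c₂ f p) (hc : 0 < c₁)
    {A B ξ η : ℝ} (hA : A ≤ ξ) (hξη : ξ ≤ η) (hB : η ≤ B) :
    ∃ C : ℝ, 0 < C ∧ ∀ lam a q z : ℝ, 0 < lam → 1 ≤ q → p z = -(a / q) → A ≤ z → z ≤ B →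
      nearMeasure ξ η lam (fun x => a * x + q * f x) ≤ C * (lam + √(lam / q)) ∧
      (2 * lam < nint (a * z + q * f z) → nearMeasure ξ η lam (fun x => a * x + q * f x) ≤
        C * (lam + lam / √(q * nint (a * z + q * f z)))) := by
  have hc₂ : 0 < c₂ := hc.trans_le hf.le
  set C₀ := 8 * √(2 * c₂) / c₁ * √(c₂ * (B - A) ^ 2 / 2 + 1) with hC₀
  have hC₀' : 0 ≤ C₀ := by positivity
  have hL : 0 ≤ η - ξ := by linarith
  refine ⟨C₀ + 4 * (η - ξ) + 2 * √(4 / c₁) + 4 * √c₂ / c₁ + 1, by positivity, ?_⟩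
  intro lam a q z hlam hq hz hzA hzB
  have hq0 : 0 < q := by linarith
  have hpos1 : 0 ≤ 2 * √(4 / c₁) := by positivity
  have hpos2 : 0 ≤ 4 * √c₂ / c₁ := by positivity
  rcases lt_or_ge (1 / 4) lam with hbig | hsmall
  · have h := nearMeasure_le_length hξη lam (fun x => a * x + q * f x)
    have h1 : ∀ w : ℝ, 0 ≤ w →
        η - ξ ≤ (C₀ + 4 * (η - ξ) + 2 * √(4 / c₁) + 4 * √c₂ / c₁ + 1) * (lam + w) := by
      intro w hw
      calc η - ξ ≤ 4 * (η - ξ) * (lam + w) := by nlinarith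
        _ ≤ _ := by gcongr; linarith
    exact ⟨h.trans (h1 _ (by positivity)), fun _ => h.trans (h1 _ (by positivity))⟩
  have h0 := nearMeasure_le_level_zero_add hf hc hA hB hlam hsmall hq hz hzA hzB
  rw [← hC₀] at h0
  constructor
  · have h1 := volume_level_le hf hc hq0 hlam ξ η z
      (a * z + q * f z - round (a * z + q * f z))
    have e : √(4 * lam / (c₁ * q)) = √(4 / c₁) * √(lam / q) := by
      rw [← Real.sqrt_mul (by positivity)]
      congr 1
      field_simp
    rw [e] at h1
    have : 0 ≤ √(lam / q) := Real.sqrt_nonneg _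
    have m1 : 0 ≤ (4 * (η - ξ) + 2 * √(4 / c₁) + 4 * √c₂ / c₁ + 1) * lam := by positivity
    have m2 : 0 ≤ (C₀ + 4 * (η - ξ) + 4 * √c₂ / c₁ + 1) * √(lam / q) := by positivity
    linarith
  · intro hδ
    set δ := nint (a * z + q * f z) with hδd
    have hδ0 : 0 < δ := by linarith
    have h1 := volume_level_le_of_dist hf hc hq0 hlam (r := √(δ / (c₂ * q)))
      (Real.sqrt_pos.2 (by positivity)) ξ η z (a * z + q * f z - round (a * z + q * f z)) (by
        intro x _ hx
        rw [Real.sq_sqrt (by positivity), div_le_iff₀ (by positivity)]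
        have h1 := (hf z x).2
        have h2 := (hf z x).1
        have h3 : q * (f x - f z - p z * (x - z)) ≤ q * (c₂ / 2 * (x - z) ^ 2) := by gcongr
        have h4 : 0 ≤ q * (f x - f z - p z * (x - z)) :=
          mul_nonneg hq0.le (le_trans (by positivity) h2)
        have h5 : δ ≤ |q * (f x - f z - p z * (x - z)) +
            (a * z + q * f z - round (a * z + q * f z))| +
            |q * (f x - f z - p z * (x - z))| := by
          rw [hδd, nint]
          refine le_trans (le_of_eq ?_) (abs_sub _ _)
          congr 1
          ring
        rw [abs_of_nonneg h4] at h5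
        nlinarith)
    have e : 2 * (2 * lam / (c₁ * q * √(δ / (c₂ * q)))) =
        4 * √c₂ / c₁ * (lam / √(q * δ)) := by
      rw [Real.sqrt_div hδ0.le, Real.sqrt_mul hc₂.le, Real.sqrt_mul hq0.le]
      have hs : √q ^ 2 = q := Real.sq_sqrt hq0.le
      have : 0 < √q := Real.sqrt_pos.2 hq0
      have : 0 < √δ := Real.sqrt_pos.2 hδ0
      field_simp
      rw [hs]
      ring
    rw [e] at h1
    have : 0 ≤ lam / √(q * δ) := by positivity
    have m1 : 0 ≤ (4 * (η - ξ) + 2 * √(4 / c₁) + 4 * √c₂ / c₁ + 1) * lam := by positivity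
    have m2 : 0 ≤ (C₀ + 4 * (η - ξ) + 2 * √(4 / c₁) + 1) * (lam / √(q * δ)) := by positivity
    linarith

end Forms

section Dyadic

variable {c₁ c₂ : ℝ} {f p X : ℝ → ℝ}

lemma exists_pow_le_of_near {lam Q q δ W C : ℝ} (hlam : 0 < lam) (hQ : 1 ≤ Q) (hlQ : lam * Q < 1)
    (hqQ : Q < 2 * q) (hC : 0 ≤ C)
    (h1 : W ≤ C * (lam + √(lam / q))) (h2 : 2 * lam < δ → W ≤ C * (lam + lam / √(q * δ))) :
    W ≤ 2 * C * lam ∨ ∃ i : ℕ, δ ≤ 4 * lam * 4 ^ i / Q * q ∧ (4 : ℝ) ^ i ≤ 4 / (lam * Q) ∧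
      W ≤ C * lam + 2 * C * √(lam / Q) / 2 ^ i := by
  have hQ0 : 0 < Q := by linarith
  have hq0 : 0 < q := by linarith
  have hlQ0 : 0 < lam * Q := by positivity
  rcases le_or_gt δ (4 * lam / Q * q) with hδ | hδ
  · refine Or.inr ⟨0, by simpa using hδ, ?_, ?_⟩
    · rw [le_div_iff₀ hlQ0]
      linarith
    · have : √(lam / q) ≤ 2 * √(lam / Q) := by
        rw [Real.sqrt_le_left (by positivity), mul_pow, Real.sq_sqrt (by positivity),
          div_le_iff₀ hq0]
        field_simp
        linarith
      have : C * √(lam / q) ≤ C * (2 * √(lam / Q)) := by gcongr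
      rw [pow_zero, div_one]
      linarith
  have hδ2 : 2 * lam < δ := by
    refine lt_of_le_of_lt ?_ hδ
    rw [div_mul_eq_mul_div, le_div_iff₀ hQ0]
    nlinarith
  have hδ0 : 0 < δ := by linarith
  replace h2 := h2 hδ2
  rcases le_or_gt 1 (q * δ) with hqδ | hqδ
  · left
    have h3 : lam / √(q * δ) ≤ lam := div_le_self hlam.le (Real.one_le_sqrt.2 hqδ)
    have : C * (lam / √(q * δ)) ≤ C * lam := by gcongr
    linarith
  · right
    obtain ⟨n, hn, hn'⟩ := exists_nat_pow_near (x := δ / q * Q / (4 * lam)) (y := (4 : ℝ)) (by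
      rw [le_div_iff₀ (by positivity), one_mul, div_mul_eq_mul_div, le_div_iff₀ hq0]
      rw [div_mul_eq_mul_div, div_lt_iff₀ hQ0] at hδ
      exact hδ.le) (by norm_num)
    rw [le_div_iff₀ (by positivity), div_mul_eq_mul_div, le_div_iff₀ hq0] at hn
    rw [div_lt_iff₀ (by positivity), div_mul_eq_mul_div, div_lt_iff₀ hq0] at hn'
    refine ⟨n + 1, ?_, ?_, ?_⟩
    · rw [div_mul_eq_mul_div, le_div_iff₀ hQ0]
      linarith
    · rw [pow_succ, le_div_iff₀ hlQ0]
      have h5 : 4 ^ n * (lam * Q) * (4 * q ^ 2) ≤ Q ^ 2 := by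
        have : 4 ^ n * (4 * lam) * q * (q * Q) ≤ δ * Q * (q * Q) := by gcongr
        nlinarith
      have h6 : Q ^ 2 ≤ 4 * q ^ 2 := by nlinarith
      have h7 : 0 < 4 * q ^ 2 := by positivity
      have : 4 ^ n * (lam * Q) ≤ 1 := by
        refine le_of_mul_le_mul_right ?_ h7
        linarith
      linarith
    · have h5 : lam / √(q * δ) ≤ 2 * √(lam / Q) / 2 ^ (n + 1) := by
        have e4 : (4 : ℝ) ^ n = (2 ^ n) ^ 2 := by
          rw [← pow_mul, mul_comm, pow_mul]
          norm_num
        have h6 : lam / (√(lam / Q) / 2 ^ n) ≤ √(q * δ) := by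
          apply Real.le_sqrt_of_sq_le
          rw [div_pow, div_pow, Real.sq_sqrt (by positivity), ← e4]
          have e : lam ^ 2 / (lam / Q / 4 ^ n) = lam * Q * 4 ^ n := by
            field_simp
          rw [e]
          have h7 : 4 ^ n * (4 * lam) * q * q ≤ δ * Q * q := by gcongr
          refine le_of_mul_le_mul_right ?_ hQ0
          have h8 : Q ^ 2 ≤ 4 * q ^ 2 := by nlinarith
          have h9 : 4 ^ n * lam * Q ^ 2 ≤ 4 ^ n * lam * (4 * q ^ 2) := by gcongr
          nlinarith
        have h7 : 0 < √(lam / Q) / 2 ^ n := by positivity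
        rw [div_le_iff₀ h7] at h6
        rw [div_le_iff₀ (by positivity)]
        refine h6.trans (le_of_eq ?_)
        rw [pow_succ]
        field_simp
      have : C * (lam / √(q * δ)) ≤ C * (2 * √(lam / Q) / 2 ^ (n + 1)) := by gcongr
      refine h2.trans ?_
      rw [mul_add]
      refine add_le_add le_rfl (this.trans (le_of_eq ?_))
      ring

lemma exists_sum_block_le (hf : QuadraticDeviation c₁ c₂ f p) (hc : 0 < c₁)
    (hX : ∀ s, p (X s) = s) {A B ξ η : ℝ} (hA : A ≤ ξ) (hξη : ξ ≤ η) (hB : η ≤ B) :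
    ∃ C : ℝ, 0 < C ∧ ∀ (lam : ℝ) (Q : ℕ), 0 < lam → 1 ≤ Q →
      ∀ S : Finset (ℤ × ℤ), (∀ j ∈ S, 0 < j.2 ∧ j.2 ≤ Q ∧ A ≤ X (-((j.1 : ℝ) / j.2)) ∧
        X (-((j.1 : ℝ) / j.2)) ≤ B) → (∀ j ∈ S, (Q : ℤ) < 2 * j.2) →
      ∑ j ∈ S, nearMeasure ξ η lam (fun x => j.1 * x + j.2 * f x) ≤
        C * (lam * (Q : ℝ) ^ 2 + √(lam * Q) * (1 + Real.log Q)) := by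
  classical
  obtain ⟨C₁, hC₁, hmeas⟩ := exists_nearMeasure_le hf hc hA hξη hB
  obtain ⟨C₂, hC₂, hcount⟩ := exists_card_pairs_le hf hc hX (hA.trans (hξη.trans hB))
  set C₃ := 2 * (|p A| + |p B|) + 1 with hC₃
  have hC₃0 : 0 < C₃ := by positivity
  refine ⟨3 * C₁ * C₃ + 64 * C₁ * C₂, by positivity, ?_⟩
  intro lam Q hlam hQ S hS hSQ
  have hQ1 : (1 : ℝ) ≤ Q := by exact_mod_cast hQ
  have hQ0 : (0 : ℝ) < Q := by linarith
  have hlog : 0 ≤ Real.log Q := Real.log_nonneg hQ1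
  have hcard : (S.card : ℝ) ≤ C₃ * (Q : ℝ) ^ 2 := card_pairs_le hf hc hX hQ S hS
  have hlQ0 : 0 < lam * Q := by positivity
  have hrest : 0 ≤ √(lam * Q) * (1 + Real.log Q) := by positivity
  have hmain : 0 ≤ lam * (Q : ℝ) ^ 2 := by positivity
  have hflat : ∑ _j ∈ S, 3 * C₁ * lam ≤ 3 * C₁ * C₃ * (lam * (Q : ℝ) ^ 2) := by
    rw [Finset.sum_const, nsmul_eq_mul]
    have : (S.card : ℝ) * (3 * C₁ * lam) ≤ C₃ * (Q : ℝ) ^ 2 * (3 * C₁ * lam) := by gcongr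
    linarith
  have hstat : ∀ j ∈ S, (1 : ℝ) ≤ j.2 ∧ p (X (-((j.1 : ℝ) / j.2))) = -((j.1 : ℝ) / j.2) ∧
      (Q : ℝ) < 2 * j.2 := by
    intro j hj
    exact ⟨by exact_mod_cast (hS j hj).1, hX _, by exact_mod_cast hSQ j hj⟩
  have hC12 : 0 ≤ 64 * C₁ * C₂ := by positivity
  have hC13 : 0 ≤ 3 * C₁ * C₃ := by positivity
  rcases le_or_gt 1 (lam * Q) with hlQ | hlQ
  · refine (Finset.sum_le_sum (g := fun _ => 3 * C₁ * lam) fun j hj => ?_).trans (hflat.trans ?_)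
    · obtain ⟨hq1, hz, hqQ⟩ := hstat j hj
      obtain ⟨-, -, hzA, hzB⟩ := hS j hj
      refine (hmeas lam j.1 j.2 _ hlam hq1 hz hzA hzB).1.trans ?_
      have : √(lam / j.2) ≤ 2 * lam := by
        rw [Real.sqrt_le_left (by positivity), div_le_iff₀ (by linarith)]
        nlinarith
      nlinarith
    · nlinarith
  obtain ⟨N, hN, hN'⟩ := exists_nat_pow_near (x := 4 / (lam * Q)) (y := (4 : ℝ)) (by
    rw [le_div_iff₀ hlQ0]; linarith) (by norm_num)
  let δ : ℤ × ℤ → ℝ := fun j =>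
    nint (j.1 * X (-((j.1 : ℝ) / j.2)) + j.2 * f (X (-((j.1 : ℝ) / j.2))))
  have hj : ∀ j ∈ S, nearMeasure ξ η lam (fun x => j.1 * x + j.2 * f x) ≤ 3 * C₁ * lam +
      ∑ i ∈ Finset.range (N + 1), if δ j ≤ 4 * lam * 4 ^ i / Q * j.2 then
        2 * C₁ * √(lam / Q) / 2 ^ i else 0 := by
    intro j hj
    obtain ⟨hq1, hz, hqQ⟩ := hstat j hj
    obtain ⟨-, -, hzA, hzB⟩ := hS j hj
    obtain ⟨m1, m2⟩ := hmeas lam j.1 j.2 _ hlam hq1 hz hzA hzB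
    have hCl : 0 ≤ C₁ * lam := by positivity
    have hterm : ∀ i ∈ Finset.range (N + 1), 0 ≤ if δ j ≤ 4 * lam * 4 ^ i / Q * j.2 then
        2 * C₁ * √(lam / Q) / 2 ^ i else 0 := by
      intro i _
      split_ifs <;> positivity
    rcases exists_pow_le_of_near hlam hQ1 hlQ hqQ hC₁.le m1 m2 with h | ⟨i, h1, h2, h3⟩
    · have := Finset.sum_nonneg hterm
      linarith
    · have hiN : i ∈ Finset.range (N + 1) := by
        rw [Finset.mem_range]
        exact (pow_lt_pow_iff_right₀ (by norm_num : (1 : ℝ) < 4)).1 (h2.trans_lt hN')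
      have := Finset.single_le_sum hterm hiN
      rw [if_pos h1] at this
      linarith
  have hlevel : ∀ i ∈ Finset.range (N + 1),
      (∑ j ∈ S, if δ j ≤ 4 * lam * 4 ^ i / Q * j.2 then 2 * C₁ * √(lam / Q) / 2 ^ i else 0) ≤
        2 * C₁ * C₂ * (√(lam * Q) * (1 + Real.log Q)) * (1 / 2) ^ i +
          8 * C₁ * C₂ * (lam * √(lam * Q) * (Q : ℝ) ^ 2) * 2 ^ i := by
    intro i _
    rw [← Finset.sum_filter, Finset.sum_const, nsmul_eq_mul]
    have h1 := hcount Q (4 * lam * 4 ^ i / Q) hQ (by positivity)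
      (S.filter fun j => δ j ≤ 4 * lam * 4 ^ i / Q * j.2) (by
        intro j hj
        rw [Finset.mem_filter] at hj
        obtain ⟨k1, k2, k3, k4⟩ := hS j hj.1
        exact ⟨k1, k2, k3, k4, hj.2⟩)
    have e1 : √(lam * Q) = √(lam / Q) * Q := by
      have : lam * Q = lam / Q * (Q : ℝ) ^ 2 := by field_simp
      rw [this, Real.sqrt_mul (by positivity), Real.sqrt_sq hQ0.le]
    have e4 : (4 : ℝ) ^ i = 2 ^ i * 2 ^ i := by
      rw [← mul_pow]
      norm_num
    refine (mul_le_mul_of_nonneg_right h1 (by positivity)).trans (le_of_eq ?_)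
    rw [e1, e4, one_div, inv_pow]
    field_simp
    ring
  have hgeom : ∑ i ∈ Finset.range (N + 1), (1 / 2 : ℝ) ^ i ≤ 2 := sum_geometric_two_le _
  have hgeom' : ∑ i ∈ Finset.range (N + 1), (2 : ℝ) ^ i ≤ 2 * 2 ^ N := by
    rw [geom_sum_eq (by norm_num), pow_succ]
    have : (0 : ℝ) < 2 ^ N := by positivity
    linarith
  have hpow : √(lam * Q) * 2 ^ N ≤ 2 := by
    have e4 : (4 : ℝ) ^ N = (2 ^ N) ^ 2 := by
      rw [← pow_mul, mul_comm, pow_mul]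
      norm_num
    rw [le_div_iff₀ hlQ0, e4] at hN
    refine le_of_sq_le_sq ?_ (by norm_num)
    rw [mul_pow, Real.sq_sqrt hlQ0.le]
    linarith
  refine (Finset.sum_le_sum hj).trans ?_
  rw [Finset.sum_add_distrib, Finset.sum_comm]
  refine (add_le_add hflat (Finset.sum_le_sum hlevel)).trans ?_
  rw [Finset.sum_add_distrib, ← Finset.mul_sum, ← Finset.mul_sum]
  have t1 : 2 * C₁ * C₂ * (√(lam * Q) * (1 + Real.log Q)) *
      ∑ i ∈ Finset.range (N + 1), (1 / 2 : ℝ) ^ i ≤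
      2 * C₁ * C₂ * (√(lam * Q) * (1 + Real.log Q)) * 2 := by gcongr
  have t2 : 8 * C₁ * C₂ * (lam * √(lam * Q) * (Q : ℝ) ^ 2) *
      ∑ i ∈ Finset.range (N + 1), (2 : ℝ) ^ i ≤ 32 * C₁ * C₂ * (lam * (Q : ℝ) ^ 2) := by
    calc _ ≤ 8 * C₁ * C₂ * (lam * √(lam * Q) * (Q : ℝ) ^ 2) * (2 * 2 ^ N) := by gcongr
      _ = 16 * C₁ * C₂ * (lam * (Q : ℝ) ^ 2) * (√(lam * Q) * 2 ^ N) := by ring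
      _ ≤ 16 * C₁ * C₂ * (lam * (Q : ℝ) ^ 2) * 2 := by gcongr
      _ = _ := by ring
  have u1 : 0 ≤ C₁ * C₂ * (√(lam * Q) * (1 + Real.log Q)) := by positivity
  have u2 : 0 ≤ C₁ * C₂ * (lam * (Q : ℝ) ^ 2) := by positivity
  have u3 : 0 ≤ C₁ * C₃ * (√(lam * Q) * (1 + Real.log Q)) := by positivity
  linarith

lemma exists_sum_near_le (hf : QuadraticDeviation c₁ c₂ f p) (hc : 0 < c₁)
    (hX : ∀ s, p (X s) = s) {A B ξ η : ℝ} (hA : A ≤ ξ) (hξη : ξ ≤ η) (hB : η ≤ B) :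
    ∃ C : ℝ, 0 < C ∧ ∀ (lam L : ℝ) (Q : ℕ), 0 < lam → 1 + Real.log Q ≤ L →
      ∀ S : Finset (ℤ × ℤ), (∀ j ∈ S, 0 < j.2 ∧ j.2 ≤ Q ∧ A ≤ X (-((j.1 : ℝ) / j.2)) ∧
        X (-((j.1 : ℝ) / j.2)) ≤ B) →
      ∑ j ∈ S, nearMeasure ξ η lam (fun x => j.1 * x + j.2 * f x) ≤
        C * (lam * (Q : ℝ) ^ 2 + √(lam * Q) * L) := by
  classical
  obtain ⟨C, hC, hblock⟩ := exists_sum_block_le hf hc hX hA hξη hB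
  refine ⟨4 * C, by positivity, ?_⟩
  intro lam L Q hlam
  induction Q using Nat.strong_induction_on with
  | _ Q ih =>
    intro hL S hS
    rcases Nat.eq_zero_or_pos Q with rfl | hQ
    · have : S = ∅ := by
        refine Finset.eq_empty_of_forall_notMem fun j hj => ?_
        have h1 := (hS j hj).1
        have h2 := (hS j hj).2.1
        push_cast at h2
        omega
      simp [this]
    have hQ1 : (1 : ℝ) ≤ Q := by exact_mod_cast hQ
    have hL0 : 0 ≤ L := by
      have := Real.log_nonneg hQ1
      linarith
    have hhalf : ((Q / 2 : ℕ) : ℝ) ≤ Q / 2 := Nat.cast_div_le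
    have hhalf0 : (0 : ℝ) ≤ ((Q / 2 : ℕ) : ℝ) := Nat.cast_nonneg _
    have h1 := ih (Q / 2) (by omega) (by
        rcases Nat.eq_zero_or_pos (Q / 2) with h0 | h0
        · rw [h0, Nat.cast_zero, Real.log_zero]
          linarith [Real.log_nonneg hQ1]
        · have := Real.log_le_log (Nat.cast_pos.2 h0) (show ((Q / 2 : ℕ) : ℝ) ≤ Q by linarith)
          linarith) (S.filter fun j => j.2 ≤ (Q / 2 : ℕ)) (by
        intro j hj
        rw [Finset.mem_filter] at hj
        obtain ⟨k1, -, k3, k4⟩ := hS j hj.1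
        exact ⟨k1, hj.2, k3, k4⟩)
    have h2 := hblock lam Q hlam hQ (S.filter fun j => ¬ j.2 ≤ (Q / 2 : ℕ))
      (fun j hj => hS j (Finset.mem_filter.1 hj).1) (by
        intro j hj
        have := (Finset.mem_filter.1 hj).2
        push_cast at this
        omega)
    rw [← Finset.sum_filter_add_sum_filter_not S fun j => j.2 ≤ ((Q / 2 : ℕ) : ℤ)]
    refine (add_le_add h1 h2).trans ?_
    have hs : √(lam * (Q / 2 : ℕ)) ≤ 3 / 4 * √(lam * Q) := by
      rw [Real.sqrt_le_left (by positivity), mul_pow, Real.sq_sqrt (by positivity)]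
      have : lam * (Q / 2 : ℕ) ≤ lam * (Q / 2) := by gcongr
      have : 0 ≤ lam * Q := by positivity
      linarith
    have h3 : lam * ((Q / 2 : ℕ) : ℝ) ^ 2 ≤ lam * ((Q : ℝ) / 2) ^ 2 := by gcongr
    have h4 : √(lam * (Q / 2 : ℕ)) * L ≤ 3 / 4 * √(lam * Q) * L := by gcongr
    have h5 : √(lam * Q) * (1 + Real.log Q) ≤ √(lam * Q) * L := by gcongr
    have h6 : 0 ≤ lam * (Q : ℝ) ^ 2 := by positivity
    have h7 : 4 * C * (lam * ((Q / 2 : ℕ) : ℝ) ^ 2 + √(lam * (Q / 2 : ℕ)) * L) ≤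
        4 * C * (lam * ((Q : ℝ) / 2) ^ 2 + 3 / 4 * √(lam * Q) * L) := by gcongr
    have h8 : C * (lam * (Q : ℝ) ^ 2 + √(lam * Q) * (1 + Real.log Q)) ≤
        C * (lam * (Q : ℝ) ^ 2 + √(lam * Q) * L) := by gcongr
    have h9 : 0 ≤ C * (lam * (Q : ℝ) ^ 2) := by positivity
    linarith

end Dyadic

lemma exists_sum_box_le {c₁ c₂ : ℝ} {f p X : ℝ → ℝ} (hf : QuadraticDeviation c₁ c₂ f p)
    (hc : 0 < c₁) (hX : ∀ s, p (X s) = s) {ξ η : ℝ} (hξη : ξ ≤ η) :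
    ∃ K : ℝ, 0 < K ∧ ∀ J : ℕ, 2 ≤ J → ∀ lam : ℝ, 0 < lam → lam < 1 / 2 →
      ∑ j ∈ (Finset.Icc (-(J : ℤ)) J ×ˢ Finset.Icc (-(J : ℤ)) J).erase (0, 0),
        nearMeasure ξ η lam (fun x => j.1 * x + j.2 * f x) ≤
      K * (lam * (J : ℝ) ^ 2 + √(lam * J) * Real.log J) := by
  classical
  have hc₂ : 0 < c₂ := hc.trans_le hf.le
  have hL : 0 ≤ η - ξ := by linarith
  obtain ⟨C, hC, hnear⟩ := exists_sum_near_le hf hc hX (A := ξ - 1) (B := η + 1) (by linarith) hξη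
    (by linarith)
  set C' := 4 * (c₂ * (1 + (η - ξ)) / c₁) * (η - ξ) + 4 / c₁ with hC'
  have hC'0 : 0 < C' := by positivity
  set C'' := 4 * 1 * (η - ξ) + 4 with hC''
  have hC''0 : 0 < C'' := by positivity
  refine ⟨9 * C'' + 2 * (9 * C' + 3 * C), by positivity, ?_⟩
  intro J hJ lam hlam hlam'
  have hJ2 : (2 : ℝ) ≤ J := by exact_mod_cast hJ
  have hlog : 1 ≤ 2 * Real.log J := by
    have h1 := Real.log_le_log (by norm_num) hJ2
    have h2 := Real.log_two_gt_d9
    linarith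
  set w : ℤ × ℤ → ℝ := fun j => nearMeasure ξ η lam (fun x => j.1 * x + j.2 * f x) with hw
  have hwneg : ∀ j, w (-j) = w j := by
    intro j
    rw [hw]
    dsimp only
    rw [← nearMeasure_neg]
    congr 1
    funext x
    rw [Prod.fst_neg, Prod.snd_neg]
    push_cast
    ring
  set E := (Finset.Icc (-(J : ℤ)) J ×ˢ Finset.Icc (-(J : ℤ)) J).erase (0, 0) with hE
  have hmem : ∀ j, j ∈ E ↔ j ≠ 0 ∧ (-(J : ℤ) ≤ j.1 ∧ j.1 ≤ J) ∧ (-(J : ℤ) ≤ j.2 ∧ j.2 ≤ J) := by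
    intro j
    rw [hE, Finset.mem_erase, Finset.mem_product, Finset.mem_Icc, Finset.mem_Icc]
    rfl
  have hEcard : (E.card : ℝ) ≤ 9 * (J : ℝ) ^ 2 := by
    have h1 : E.card ≤ (2 * J + 1) * (2 * J + 1) := by
      refine (Finset.card_erase_le).trans (le_of_eq ?_)
      rw [Finset.card_product, Int.card_Icc]
      congr 1 <;> omega
    have h2 : (E.card : ℝ) ≤ (2 * J + 1) * (2 * J + 1) := by exact_mod_cast h1
    nlinarith
  have hflat : ∀ (D : ℝ), 0 ≤ D → ∀ S ⊆ E, (∀ j ∈ S, w j ≤ D * lam) →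
      ∑ j ∈ S, w j ≤ 9 * D * (lam * (J : ℝ) ^ 2) := by
    intro D hD S hSE hS
    refine (Finset.sum_le_card_nsmul _ _ _ hS).trans ?_
    rw [nsmul_eq_mul]
    calc _ ≤ 9 * (J : ℝ) ^ 2 * (D * lam) := by
          gcongr
          exact (Nat.cast_le.2 (Finset.card_le_card hSE)).trans hEcard
      _ = _ := by ring
  have hzero : ∑ j ∈ E.filter (fun j => j.2 = 0), w j ≤ 9 * C'' * (lam * (J : ℝ) ^ 2) := by
    refine hflat C'' hC''0.le _ (Finset.filter_subset _ _) fun j hj => ?_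
    rw [Finset.mem_filter, hmem] at hj
    obtain ⟨⟨hj0, -⟩, hj2⟩ := hj
    have hj1 : j.1 ≠ 0 := fun h => hj0 (Prod.ext h hj2)
    have hj1' : (1 : ℝ) ≤ |(j.1 : ℝ)| := by exact_mod_cast Int.one_le_abs hj1
    have hGeq : ∀ x y : ℝ, x ≤ y →
        |(j.1 * y + j.2 * f y) - (j.1 * x + j.2 * f x)| = |(j.1 : ℝ)| * (y - x) := by
      intro x y hxy
      rw [hj2, Int.cast_zero, zero_mul, zero_mul, add_zero, add_zero, ← mul_sub, abs_mul,
        abs_of_nonneg (show 0 ≤ y - x by linarith)]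
    refine (nearMeasure_le_of_expanding (D := |(j.1 : ℝ)|) (κ := 1) hξη hlam hlam' (by linarith)
      zero_le_one (fun x _ y _ hxy => (hGeq x y hxy).ge)
      (fun x _ y _ hxy => by rw [hGeq x y hxy, one_mul])).trans ?_
    have : 4 / |(j.1 : ℝ)| ≤ 4 := div_le_self (by norm_num) hj1'
    rw [hC'']
    gcongr
  have hpos : ∑ j ∈ E.filter (fun j => 0 < j.2), w j ≤
      9 * C' * (lam * (J : ℝ) ^ 2) + C * (lam * (J : ℝ) ^ 2 + √(lam * J) * (1 + Real.log J)) := by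
    rw [← Finset.sum_filter_not_add_sum_filter (E.filter fun j => 0 < j.2) fun j =>
      ξ - 1 ≤ X (-((j.1 : ℝ) / j.2)) ∧ X (-((j.1 : ℝ) / j.2)) ≤ η + 1]
    refine add_le_add (hflat C' hC'0.le _
      ((Finset.filter_subset _ _).trans (Finset.filter_subset _ _)) fun j hj => ?_)
      (hnear lam _ J hlam le_rfl _ fun j hj => ?_)
    · rw [Finset.mem_filter, Finset.mem_filter] at hj
      refine nearMeasure_le_of_far hf hc hξη hlam hlam' (by exact_mod_cast hj.1.2)
        (hX (-((j.1 : ℝ) / j.2))) ?_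
      by_contra! hcon
      exact hj.2 ⟨hcon.1.le, hcon.2.le⟩
    · rw [Finset.mem_filter, Finset.mem_filter, hmem] at hj
      exact ⟨hj.1.2, hj.1.1.2.2.2, hj.2⟩
  have hneg : ∑ j ∈ E.filter (fun j => j.2 < 0), w j = ∑ j ∈ E.filter (fun j => 0 < j.2), w j := by
    refine Finset.sum_nbij' (fun j => -j) (fun j => -j) ?_ ?_ (fun j _ => neg_neg j)
      (fun j _ => neg_neg j) (fun j _ => (hwneg j).symm)
    all_goals
      intro j hj
      rw [Finset.mem_filter, hmem] at hj ⊢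
      rw [neg_ne_zero, Prod.fst_neg, Prod.snd_neg]
      exact ⟨⟨hj.1.1, by omega, by omega⟩, by omega⟩
  have hsplit : ∑ j ∈ E, w j = ∑ j ∈ E.filter (fun j => j.2 = 0), w j +
      (∑ j ∈ E.filter (fun j => j.2 < 0), w j + ∑ j ∈ E.filter (fun j => 0 < j.2), w j) := by
    simp only [Finset.sum_filter]
    rw [← Finset.sum_add_distrib, ← Finset.sum_add_distrib]
    refine Finset.sum_congr rfl fun j _ => ?_
    rcases lt_trichotomy j.2 0 with h | h | h
    · simp [h, h.ne, h.not_gt]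
    · simp [h]
    · simp [h, h.ne', h.not_gt]
  rw [hsplit, hneg]
  have hs : 0 ≤ √(lam * J) := Real.sqrt_nonneg _
  have h3 : √(lam * J) * (1 + Real.log J) ≤ √(lam * J) * (3 * Real.log J) := by
    gcongr
    linarith
  have h4 : C * (lam * (J : ℝ) ^ 2 + √(lam * J) * (1 + Real.log J)) ≤
      C * (lam * (J : ℝ) ^ 2 + √(lam * J) * (3 * Real.log J)) := by gcongr
  have h5 : 0 ≤ √(lam * J) * Real.log J := mul_nonneg hs (by linarith)
  have h6 : 0 ≤ C * (lam * (J : ℝ) ^ 2) := by positivity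
  have h7 : 0 ≤ (9 * C'' + 18 * C') * (√(lam * J) * Real.log J) :=
    mul_nonneg (by positivity) h5
  linarith

lemma nonneg_of_deriv_sign {k k' : ℝ → ℝ} {x : ℝ} (hk : ∀ y, HasDerivAt k (k' y) y) (h0 : k x = 0)
    (hr : ∀ y, x ≤ y → 0 ≤ k' y) (hl : ∀ y, y ≤ x → k' y ≤ 0) (y : ℝ) : 0 ≤ k y := by
  have hcont : Continuous k := continuous_iff_continuousAt.2 fun y => (hk y).continuousAt
  rcases lt_trichotomy x y with h | h | h
  · obtain ⟨z, hz, e⟩ := exists_hasDerivAt_eq_slope k k' h hcont.continuousOn fun z _ => hk z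
    rw [eq_div_iff (by linarith)] at e
    have := mul_nonneg (hr z hz.1.le) (sub_nonneg.2 h.le)
    linarith
  · rw [← h, h0]
  · obtain ⟨z, hz, e⟩ := exists_hasDerivAt_eq_slope k k' h hcont.continuousOn fun z _ => hk z
    rw [eq_div_iff (by linarith)] at e
    have := mul_nonneg_of_nonpos_of_nonpos (hl z hz.2.le) (sub_nonpos.2 h.le)
    nlinarith

lemma quadraticDeviation_of_hasDerivAt {c₁ c₂ : ℝ} {f p : ℝ → ℝ} (hf : ∀ x, HasDerivAt f (p x) x)
    (hp : ∀ x y, x ≤ y → c₁ * (y - x) ≤ p y - p x ∧ p y - p x ≤ c₂ * (y - x)) :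
    QuadraticDeviation c₁ c₂ f p := by
  have hderiv : ∀ c x y, HasDerivAt (fun y => f y - f x - p x * (y - x) - c / 2 * (y - x) ^ 2)
      (p y - p x - c * (y - x)) y := by
    intro c x y
    have h1 : HasDerivAt (fun y : ℝ => y - x) 1 y := (hasDerivAt_id y).sub_const x
    refine ((((hf y).sub_const (f x)).sub (h1.const_mul (p x))).sub
      ((h1.pow 2).const_mul (c / 2))).congr_deriv ?_
    simp only [Nat.cast_ofNat]
    ring
  intro x y
  constructor
  · have := nonneg_of_deriv_sign (hderiv c₁ x) (by ring)
      (fun y hy => by linarith [(hp x y hy).1]) (fun y hy => by linarith [(hp y x hy).1]) y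
    linarith
  · have := nonneg_of_deriv_sign (x := x) (fun y => (hderiv c₂ x y).neg) (by simp)
      (fun y hy => by linarith [(hp x y hy).2]) (fun y hy => by linarith [(hp y x hy).2]) y
    simp only [Pi.neg_apply] at this
    linarith

lemma exists_quadraticDeviation_extension {ξ η c₁ c₂ : ℝ} (hξη : ξ ≤ η) (hc₁ : 0 < c₁)
    {f f' f'' : ℝ → ℝ} (hf : ∀ x ∈ Icc ξ η, HasDerivWithinAt f (f' x) (Icc ξ η) x)
    (hf' : ∀ x ∈ Icc ξ η, HasDerivWithinAt f' (f'' x) (Icc ξ η) x)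
    (hbd : ∀ x ∈ Icc ξ η, c₁ ≤ f'' x ∧ f'' x ≤ c₂) :
    ∃ F p X : ℝ → ℝ, QuadraticDeviation c₁ c₂ F p ∧ (∀ s, p (X s) = s) ∧ EqOn F f (Icc ξ η) := by
  have hc : c₁ ≤ c₂ := by
    have := hbd ξ (left_mem_Icc.2 hξη)
    linarith
  have hslope : ∀ x ∈ Icc ξ η, ∀ y ∈ Icc ξ η, x ≤ y →
      c₁ * (y - x) ≤ f' y - f' x ∧ f' y - f' x ≤ c₂ * (y - x) := by
    intro x hx y hy hxy
    rcases hxy.eq_or_lt with rfl | hlt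
    · simp
    have hsub : Icc x y ⊆ Icc ξ η := Icc_subset_Icc hx.1 hy.2
    obtain ⟨z, hz, e⟩ := exists_hasDerivAt_eq_slope f' f'' hlt
      (fun z hz => (hf' z (hsub hz)).continuousWithinAt.mono hsub)
      (fun z hz => (hf' z (hsub (Ioo_subset_Icc_self hz))).hasDerivAt
        (Icc_mem_nhds (hx.1.trans_lt hz.1) (hz.2.trans_le hy.2)))
    have hb := hbd z (hsub (Ioo_subset_Icc_self hz))
    rw [eq_div_iff (by linarith)] at e
    rw [← e]
    have : 0 ≤ y - x := by linarith
    constructor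
    · gcongr
      exact hb.1
    · gcongr
      exact hb.2
  have hcont' : ContinuousOn f' (Icc ξ η) := fun x hx => (hf' x hx).continuousWithinAt
  set cl : ℝ → ℝ := fun x => max ξ (min η x) with hcl
  have hclI : ∀ x, cl x ∈ Icc ξ η := fun x => ⟨le_max_left _ _, max_le hξη (min_le_left _ _)⟩
  have hclid : ∀ x ∈ Icc ξ η, cl x = x := by
    intro x hx
    simp only [hcl]
    rw [min_eq_right hx.2, max_eq_right hx.1]
  have hclcont : Continuous cl := by fun_prop
  have hcl2 : ∀ x y, x ≤ y → 0 ≤ cl y - cl x ∧ cl y - cl x ≤ y - x := by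
    intro x y hxy
    simp only [hcl]
    constructor
    · have : max ξ (min η x) ≤ max ξ (min η y) := by gcongr
      linarith
    · rcases le_total ξ (min η y) with h1 | h1
      · rw [max_eq_right h1]
        rcases le_total η x with h2 | h2
        · have : min η x = η := min_eq_left h2
          have := le_max_right ξ (min η x)
          have := min_le_left η y
          linarith
        · have : min η x = x := min_eq_right h2
          have := le_max_right ξ (min η x)
          have := min_le_right η y
          linarith
      · rw [max_eq_left h1]
        have := le_max_left ξ (min η x)
        linarith
  set p : ℝ → ℝ := fun x => f' (cl x) + c₁ * (x - cl x) with hp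
  have hpcont : Continuous p := by
    have : Continuous fun x => f' (cl x) := hcont'.comp_continuous hclcont hclI
    exact this.add (continuous_const.mul (continuous_id.sub hclcont))
  have hpslope : ∀ x y, x ≤ y → c₁ * (y - x) ≤ p y - p x ∧ p y - p x ≤ c₂ * (y - x) := by
    intro x y hxy
    obtain ⟨h1, h2⟩ := hcl2 x y hxy
    obtain ⟨h3, h4⟩ := hslope _ (hclI x) _ (hclI y) (by linarith)
    have h5 : c₁ * ((y - x) - (cl y - cl x)) ≤ c₂ * ((y - x) - (cl y - cl x)) := by
      gcongr
    simp only [hp]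
    constructor <;> linarith
  have hpsurj : Function.Surjective p := by
    refine hpcont.surjective ?_ ?_
    · refine Filter.tendsto_atTop_mono' _ ?_
        (Filter.tendsto_atTop_add_const_right _ (p 0) (Filter.tendsto_id.const_mul_atTop hc₁))
      filter_upwards [Filter.eventually_ge_atTop 0] with x hx
      have := (hpslope 0 x hx).1
      simp only [id]
      linarith
    · refine Filter.tendsto_atBot_mono' _ ?_
        (Filter.tendsto_atBot_add_const_right _ (p 0) (Filter.tendsto_id.const_mul_atBot hc₁))
      filter_upwards [Filter.eventually_le_atBot 0] with x hx
      have := (hpslope x 0 hx).1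
      simp only [id]
      linarith
  refine ⟨fun x => f ξ + ∫ t in ξ..x, p t, p, Function.surjInv hpsurj,
    quadraticDeviation_of_hasDerivAt (fun x => ?_) hpslope, Function.surjInv_eq hpsurj, ?_⟩
  · exact (hpcont.integral_hasStrictDerivAt ξ x).hasDerivAt.const_add _
  · intro x hx
    have hsub : Icc ξ x ⊆ Icc ξ η := Icc_subset_Icc_right hx.2
    have := intervalIntegral.integral_eq_sub_of_hasDerivAt_of_le hx.1 (f := f) (f' := p)
      (fun y hy => (hf y (hsub hy)).continuousWithinAt.mono hsub)
      (fun y hy => by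
        have hyI := hsub (Ioo_subset_Icc_self hy)
        have e : p y = f' y := by
          simp only [hp]
          rw [hclid y hyI]
          ring
        rw [e]
        exact (hf y hyI).hasDerivAt (Icc_mem_nhds hy.1 (hy.2.trans_le hx.2)))
      (hpcont.intervalIntegrable _ _)
    dsimp only
    rw [this]
    ring

lemma nearMeasure_congr {ξ η lam : ℝ} {G H : ℝ → ℝ} (h : EqOn G H (Icc ξ η)) :
    nearMeasure ξ η lam G = nearMeasure ξ η lam H := by
  unfold nearMeasure
  congr 1
  ext x
  simp only [mem_sep_iff]
  exact and_congr_right fun hx => by rw [h hx]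

lemma exists_sum_box_le_of_pos {ξ η c₁ c₂ : ℝ} (hξη : ξ ≤ η) (hc₁ : 0 < c₁)
    {f f' f'' : ℝ → ℝ} (hf : ∀ x ∈ Icc ξ η, HasDerivWithinAt f (f' x) (Icc ξ η) x)
    (hf' : ∀ x ∈ Icc ξ η, HasDerivWithinAt f' (f'' x) (Icc ξ η) x)
    (hbd : ∀ x ∈ Icc ξ η, c₁ ≤ f'' x ∧ f'' x ≤ c₂) :
    ∃ K : ℝ, 0 < K ∧ ∀ J : ℕ, 2 ≤ J → ∀ lam : ℝ, 0 < lam → lam < 1 / 2 →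
      ∑ j ∈ (Finset.Icc (-(J : ℤ)) J ×ˢ Finset.Icc (-(J : ℤ)) J).erase (0, 0),
        nearMeasure ξ η lam (fun x => j.1 * x + j.2 * f x) ≤
      K * (lam * (J : ℝ) ^ 2 + √(lam * J) * Real.log J) := by
  obtain ⟨F, p, X, hF, hX, hEq⟩ := exists_quadraticDeviation_extension hξη hc₁ hf hf' hbd
  obtain ⟨K, hK, h⟩ := exists_sum_box_le hF hc₁ hX hξη
  refine ⟨K, hK, fun J hJ lam h0 h1 => (le_of_eq ?_).trans (h J hJ lam h0 h1)⟩
  refine Finset.sum_congr rfl fun j _ => nearMeasure_congr fun x hx => ?_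
  rw [hEq hx]

theorem sum_measure_mu_bound
    (ξ η c₁ c₂ : ℝ) (hξη : ξ ≤ η) (hc₁ : 0 < c₁)
    (f f' f'' : ℝ → ℝ)
    (hf : ∀ x ∈ Icc ξ η, HasDerivWithinAt f (f' x) (Icc ξ η) x)
    (hf' : ∀ x ∈ Icc ξ η, HasDerivWithinAt f' (f'' x) (Icc ξ η) x)
    (hf'' : ContinuousOn f'' (Icc ξ η))
    (hbd : ∀ x ∈ Icc ξ η, c₁ ≤ |f'' x| ∧ |f'' x| ≤ c₂) :
    ∃ K : ℝ, 0 < K ∧ ∀ J : ℕ, 2 ≤ J → ∀ lam : ℝ, 0 < lam → lam < 1/2 →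
      ∑ j ∈ (Finset.Icc (-(J : ℤ)) J ×ˢ Finset.Icc (-(J : ℤ)) J).erase (0, 0),
        (volume {x ∈ Icc ξ η | nint ((j.1 : ℝ) * x + (j.2 : ℝ) * f x) < lam}).toReal
      ≤ K * (lam * (J : ℝ) ^ 2 + lam ^ ((1 : ℝ)/2) * (J : ℝ) ^ ((1 : ℝ)/2) * Real.log J) := by
  suffices h : ∃ K : ℝ, 0 < K ∧ ∀ J : ℕ, 2 ≤ J → ∀ lam : ℝ, 0 < lam → lam < 1 / 2 →
      ∑ j ∈ (Finset.Icc (-(J : ℤ)) J ×ˢ Finset.Icc (-(J : ℤ)) J).erase (0, 0),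
        nearMeasure ξ η lam (fun x => j.1 * x + j.2 * f x) ≤
      K * (lam * (J : ℝ) ^ 2 + √(lam * J) * Real.log J) by
    obtain ⟨K, hK, h⟩ := h
    refine ⟨K, hK, fun J hJ lam h0 h1 => (h J hJ lam h0 h1).trans (le_of_eq ?_)⟩
    rw [Real.sqrt_mul h0.le, Real.sqrt_eq_rpow, Real.sqrt_eq_rpow]
  have hξI : ξ ∈ Icc ξ η := left_mem_Icc.2 hξη
  have hne : ∀ x ∈ Icc ξ η, f'' x ≠ 0 := by
    intro x hx h0
    have := (hbd x hx).1
    rw [h0, abs_zero] at this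
    linarith
  rcases lt_or_gt_of_ne (hne ξ hξI) with hneg | hpos
  · have hsign : ∀ x ∈ Icc ξ η, f'' x < 0 := by
      intro x hx
      by_contra! hx0
      obtain ⟨y, hy, hy0⟩ := isPreconnected_Icc.intermediate_value hξI hx hf'' ⟨hneg.le, hx0⟩
      exact hne y hy hy0
    obtain ⟨K, hK, h⟩ := exists_sum_box_le_of_pos hξη hc₁ (f := fun x => -f x)
      (f' := fun x => -f' x) (f'' := fun x => -f'' x) (fun x hx => (hf x hx).neg)
      (fun x hx => (hf' x hx).neg) (fun x hx => by
        have := hbd x hx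
        rwa [abs_of_neg (hsign x hx)] at this)
    refine ⟨K, hK, fun J hJ lam h0 h1 => (le_of_eq ?_).trans (h J hJ lam h0 h1)⟩
    refine Finset.sum_nbij' (fun j => (-j.1, j.2)) (fun j => (-j.1, j.2)) ?_ ?_
      (fun j _ => by simp) (fun j _ => by simp) (fun j _ => ?_)
    · intro j hj
      simp only [Finset.mem_erase, Finset.mem_product, Finset.mem_Icc, ne_eq, Prod.ext_iff] at hj ⊢
      omega
    · intro j hj
      simp only [Finset.mem_erase, Finset.mem_product, Finset.mem_Icc, ne_eq, Prod.ext_iff] at hj ⊢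
      omega
    · rw [← nearMeasure_neg]
      congr 1
      funext x
      push_cast
      ring
  · have hsign : ∀ x ∈ Icc ξ η, 0 < f'' x := by
      intro x hx
      by_contra! hx0
      obtain ⟨y, hy, hy0⟩ := isPreconnected_Icc.intermediate_value hx hξI hf'' ⟨hx0, hpos.le⟩
      exact hne y hy hy0
    exact exists_sum_box_le_of_pos hξη hc₁ hf hf' fun x hx => by
      have := hbd x hx
      rwa [abs_of_pos (hsign x hx)] at this
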